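/- Let Γ be a finite family of Jordan curves in general position, any two of which intersect in at most two points, with a distinguished curve γ ∈ Γ such that every curve of Γ ∖ {γ} intersects γ and any two curves of Γ ∖ {γ} intersect in at most one point inside the closure of γ̃. Suppose α, β ∈ Γ ∖ {γ} form with γ a half-triangle T with edge α contained in γ̃, that is: T is a connected component of ℝ² ∖ (α(S¹) ∪ β(S¹) ∪ γ(S¹)) contained in γ̃ whose frontier meets each of the three images and contains exactly three intersection points of pairs of these curves, and the open side of T on α (the frontier of T contained in α(S¹), minus the two bounding vertices) meets no curve of Γ. Suppose moreover that every curve of Γ intersects the open side of T on γ in at most one point. Then there is a triangle cell of the full arrangement of Γ lying on γ and contained in T. -/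

import Mathlib

noncomputable section

open Set Metric

abbrev Plane : Type := EuclideanSpace ℝ (Fin 2)

/-- The unit circle `S¹ ⊆ ℝ²`. -/
def unitCircle : Set Plane := Metric.sphere 0 1

/-- A Jordan curve: a continuous injective map from the unit circle to the plane. -/
structure JordanCurve : Type where
  toFun : unitCircle → Plane
  continuous : Continuous toFun
  injective : Function.Injective toFun

/-- The image of a Jordan curve. -/
def JordanCurve.img (γ : JordanCurve) : Set Plane := Set.range γ.toFun

/-- The inside of (the image of) a map from the circle to the plane: the union of the
bounded connected components of the complement of its image. -/
def insideFun (f : unitCircle → Plane) : Set Plane :=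
  {p | p ∉ Set.range f ∧ Bornology.IsBounded (connectedComponentIn (Set.range f)ᶜ p)}

/-- The inside of a Jordan curve. -/
def JordanCurve.inside (γ : JordanCurve) : Set Plane := insideFun γ.toFun

/-- Path-connectedness of a set (trivially true for the empty set). -/
def PathConn (s : Set Plane) : Prop := ∀ x ∈ s, ∀ y ∈ s, JoinedIn s x y

/-- Two Jordan curves are non-piercing if each inside minus the other is path-connected. -/
def NonPiercing (α β : JordanCurve) : Prop :=
  PathConn (α.inside \ β.inside) ∧ PathConn (β.inside \ α.inside)

/-- A family of Jordan curves is non-piercing if its members are pairwise non-piercing. -/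
def NonPiercingFamily (Γ : Set JordanCurve) : Prop :=
  ∀ α ∈ Γ, ∀ β ∈ Γ, α ≠ β → NonPiercing α β

/-- An intersection point `p` of two Jordan curves is a crossing: every neighbourhood of `p`
contains points of each curve inside the other, and points of each curve outside the closure
of the inside of the other. -/
def IsCrossing (α β : JordanCurve) (p : Plane) : Prop :=
  ∀ U ∈ nhds p,
    (∃ q ∈ U, q ∈ α.img ∧ q ∈ β.inside) ∧
    (∃ q ∈ U, q ∈ α.img ∧ q ∉ closure β.inside) ∧
    (∃ q ∈ U, q ∈ β.img ∧ q ∈ α.inside) ∧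
    (∃ q ∈ U, q ∈ β.img ∧ q ∉ closure α.inside)

/-- A finite family of Jordan curves is in general position: pairwise finite intersections,
all intersection points are crossings, and no point lies on three curves. -/
def GeneralPosition (Γ : Set JordanCurve) : Prop :=
  (∀ α ∈ Γ, ∀ β ∈ Γ, α ≠ β → (α.img ∩ β.img).Finite) ∧
  (∀ α ∈ Γ, ∀ β ∈ Γ, α ≠ β → ∀ p ∈ α.img ∩ β.img, IsCrossing α β p) ∧
  (∀ α ∈ Γ, ∀ β ∈ Γ, ∀ δ ∈ Γ, ∀ p : Plane,
      p ∈ α.img → p ∈ β.img → p ∈ δ.img → α = β ∨ β = δ ∨ α = δ)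

/-- The union of the images of the curves of a family. -/
def curvesUnion (Γ : Set JordanCurve) : Set Plane := ⋃ α ∈ Γ, α.img

/-- A cell of the arrangement of `Γ`: a connected component of the complement of the
union of the images of the curves. -/
def IsCell (Γ : Set JordanCurve) (C : Set Plane) : Prop :=
  ∃ p ∈ (curvesUnion Γ)ᶜ, C = connectedComponentIn (curvesUnion Γ)ᶜ p

/-- The vertices of the arrangement of `Γ`: intersection points of pairs of curves. -/
def arrVertices (Γ : Set JordanCurve) : Set Plane :=
  {p | ∃ α ∈ Γ, ∃ β ∈ Γ, α ≠ β ∧ p ∈ α.img ∧ p ∈ β.img}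

/-- A digon cell on `γ`: a bounded cell whose frontier lies in the union of the images of `γ`
and exactly one further curve `α`, meets both images, and contains exactly two vertices. -/
def IsDigonCellOn (Γ : Set JordanCurve) (γ : JordanCurve) (C : Set Plane) : Prop :=
  IsCell Γ C ∧ Bornology.IsBounded C ∧
  (frontier C ∩ arrVertices Γ).encard = 2 ∧
  (frontier C ∩ γ.img).Nonempty ∧
  ∃ α ∈ Γ, α ≠ γ ∧ frontier C ⊆ γ.img ∪ α.img ∧ (frontier C ∩ α.img).Nonempty ∧
    ∀ δ ∈ Γ, (frontier C ∩ δ.img).Nonempty → δ = γ ∨ δ = α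

/-- A triangle cell on `γ`: a bounded cell whose frontier lies in the union of the images of
`γ` and exactly two further curves `α, β`, meets all three images, and contains exactly three
vertices. -/
def IsTriangleCellOn (Γ : Set JordanCurve) (γ : JordanCurve) (C : Set Plane) : Prop :=
  IsCell Γ C ∧ Bornology.IsBounded C ∧
  (frontier C ∩ arrVertices Γ).encard = 3 ∧
  (frontier C ∩ γ.img).Nonempty ∧
  ∃ α ∈ Γ, ∃ β ∈ Γ, α ≠ γ ∧ β ≠ γ ∧ α ≠ β ∧
    frontier C ⊆ γ.img ∪ α.img ∪ β.img ∧
    (frontier C ∩ α.img).Nonempty ∧ (frontier C ∩ β.img).Nonempty ∧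
    ∀ δ ∈ Γ, (frontier C ∩ δ.img).Nonempty → δ = γ ∨ δ = α ∨ δ = β

/-- The pairwise intersection points of three Jordan curves. -/
def pairInts (α β γ : JordanCurve) : Set Plane :=
  (α.img ∩ β.img) ∪ (α.img ∩ γ.img) ∪ (β.img ∩ γ.img)

/-- The standard isometry of the plane with the complex numbers. -/
def toC : Plane ≃ₗᵢ[ℝ] ℂ := Complex.orthonormalBasisOneI.repr.symm

lemma toC_sub_ne_zero {z p : Plane} (h : z ≠ p) : toC z - toC p ≠ 0 :=
  sub_ne_zero.2 fun h' => h (toC.injective h')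

lemma toC_sub_ne_zero_of_mem {X : Set Plane} {z p : Plane} (hz : z ∈ X) (hp : p ∉ X) :
    toC z - toC p ≠ 0 :=
  toC_sub_ne_zero fun h => hp (h ▸ hz)

/-- `f` has a continuous logarithm on `X`. -/
def HasLog (X : Set Plane) (f : Plane → ℂ) : Prop :=
  ∃ l : Plane → ℂ, ContinuousOn l X ∧ ∀ z ∈ X, Complex.exp (l z) = f z

/-- Every nowhere vanishing continuous function on `X` has a continuous logarithm. -/
def Acyclic (X : Set Plane) : Prop :=
  ∀ f : Plane → ℂ, ContinuousOn f X → (∀ z ∈ X, f z ≠ 0) → HasLog X f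

lemma HasLog.mono {X Y : Set Plane} {f : Plane → ℂ} (h : HasLog Y f) (hXY : X ⊆ Y) :
    HasLog X f := by
  obtain ⟨l, hl, he⟩ := h
  exact ⟨l, hl.mono hXY, fun z hz => he z (hXY hz)⟩

lemma HasLog.congr {X : Set Plane} {f g : Plane → ℂ} (h : HasLog X f)
    (hfg : ∀ z ∈ X, f z = g z) : HasLog X g := by
  obtain ⟨l, hl, he⟩ := h
  exact ⟨l, hl, fun z hz => by rw [he z hz, hfg z hz]⟩

lemma HasLog.mul {X : Set Plane} {f g : Plane → ℂ} (hf : HasLog X f) (hg : HasLog X g) :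
    HasLog X (fun z => f z * g z) := by
  obtain ⟨l, hl, he⟩ := hf
  obtain ⟨m, hm, he'⟩ := hg
  exact ⟨fun z => l z + m z, hl.add hm, fun z hz => by rw [Complex.exp_add, he z hz, he' z hz]⟩

lemma HasLog.inv {X : Set Plane} {f : Plane → ℂ} (hf : HasLog X f) :
    HasLog X (fun z => (f z)⁻¹) := by
  obtain ⟨l, hl, he⟩ := hf
  exact ⟨fun z => - l z, hl.neg, fun z hz => by rw [Complex.exp_neg, he z hz]⟩

lemma exists_continuous_log {E : Type*} [NormedAddCommGroup E] [NormedSpace ℝ E] {f : E → ℂ}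
    (hf : Continuous f) (h0 : ∀ z, f z ≠ 0) :
    ∃ l : E → ℂ, Continuous l ∧ ∀ z, Complex.exp (l z) = f z := by
  have hsc : IsSimplyConnected (univ : Set E) := by
    have := (convex_univ (𝕜 := ℝ) (E := E)).contractibleSpace univ_nonempty
    exact inferInstanceAs (SimplyConnectedSpace (univ : Set E))
  obtain ⟨l, hl, he⟩ := Complex.exists_continuousOn_eqOn_exp_comp hsc isOpen_univ
    hf.continuousOn (by
      rintro ⟨z, -, hz⟩
      exact h0 z hz)
  exact ⟨l, continuousOn_univ.1 hl, fun z => he (mem_univ z)⟩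

lemma eq_const_of_exp_eq {α : Type*} [TopologicalSpace α] {S : Set α} (hS : IsPreconnected S)
    {d : α → ℂ} (hd : ContinuousOn d S) (h1 : ∀ z ∈ S, Complex.exp (d z) = 1) :
    ∀ x ∈ S, ∀ y ∈ S, d x = d y := by
  intro x hx y hy
  have hpi : (2 * Real.pi * Complex.I : ℂ) ≠ 0 := Complex.two_pi_I_ne_zero
  have hm : MapsTo (fun z => (d z / (2 * Real.pi * Complex.I)).re) S
      (range ((↑) : ℤ → ℝ)) := by
    intro z hz
    obtain ⟨n, hn⟩ := Complex.exp_eq_one_iff.1 (h1 z hz)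
    exact ⟨n, by simp [hn]⟩
  have hc : ContinuousOn (fun z => (d z / (2 * Real.pi * Complex.I)).re) S :=
    Complex.continuous_re.comp_continuousOn (hd.div_const _)
  have := hS.constant_of_mapsTo (Int.isClosedEmbedding_coe_real.isEmbedding.isDiscrete_range)
    hc hm hx hy
  obtain ⟨n, hn⟩ := Complex.exp_eq_one_iff.1 (h1 x hx)
  obtain ⟨m, hm⟩ := Complex.exp_eq_one_iff.1 (h1 y hy)
  simp only [hn, hm, mul_div_assoc, div_self hpi] at this
  have : n = m := by simpa using this
  rw [hn, hm, this]

lemma HasLog.union {X Y : Set Plane} (hX : IsClosed X) (hY : IsClosed Y)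
    (hXY : IsPreconnected (X ∩ Y)) {f : Plane → ℂ} (h1 : HasLog X f) (h2 : HasLog Y f) :
    HasLog (X ∪ Y) f := by
  classical
  obtain ⟨l, hl, hle⟩ := h1
  obtain ⟨m, hm, hme⟩ := h2
  obtain ⟨c, hc1, hc⟩ : ∃ c : ℂ, Complex.exp c = 1 ∧ ∀ z ∈ X ∩ Y, l z = m z + c := by
    rcases (X ∩ Y).eq_empty_or_nonempty with h | ⟨w, hw⟩
    · exact ⟨0, by simp, by simp [h]⟩
    · have key : ∀ z ∈ X ∩ Y, Complex.exp (l z - m z) = 1 := by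
        intro z hz
        rw [Complex.exp_sub, hle z hz.1, hme z hz.2, div_self]
        rw [← hle z hz.1]
        exact Complex.exp_ne_zero _
      refine ⟨l w - m w, key w hw, fun z hz => ?_⟩
      have := eq_const_of_exp_eq hXY
        ((hl.mono inter_subset_left).sub (hm.mono inter_subset_right)) key z hz w hw
      simp only [Pi.sub_apply] at this
      linear_combination this
  refine ⟨fun z => if z ∈ X then l z else m z + c, ?_, ?_⟩
  · apply ContinuousOn.union_of_isClosed _ _ hX hY
    · exact hl.congr fun z hz => by simp [hz]
    · refine (hm.add (continuousOn_const (c := c))).congr fun z hz => ?_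
      by_cases h : z ∈ X
      · simp [h, hc z ⟨h, hz⟩]
      · simp [h]
  · intro z hz
    by_cases h : z ∈ X
    · simp [h, hle]
    · have : z ∈ Y := hz.resolve_left h
      simp [h, Complex.exp_add, hc1, hme z this]

lemma Acyclic.union {X Y : Set Plane} (hX : IsClosed X) (hY : IsClosed Y)
    (hXY : IsPreconnected (X ∩ Y)) (h1 : Acyclic X) (h2 : Acyclic Y) : Acyclic (X ∪ Y) :=
  fun f hf h0 => HasLog.union hX hY hXY
    (h1 f (hf.mono subset_union_left) fun z hz => h0 z (Or.inl hz))
    (h2 f (hf.mono subset_union_right) fun z hz => h0 z (Or.inr hz))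

/-- A logarithm on the frontier of a bounded open set `U` of a function winding around a point of
`U` forces the exponent to vanish. -/
lemma exponent_eq_zero {U : Set Plane} (hU : IsOpen U) (hb : Bornology.IsBounded U) {p : Plane}
    (hp : p ∈ U) {k : ℤ} {h : Plane → ℂ} (hh : ContinuousOn h (closure U))
    (h0 : ∀ z ∈ closure U, h z ≠ 0)
    (hlog : HasLog (frontier U) (fun z => (toC z - toC p) ^ k * h z)) : k = 0 := by
  classical
  obtain ⟨l, hl, hle⟩ := hlog
  obtain ⟨g, hg⟩ := ContinuousMap.exists_restrict_eq (isClosed_frontier (s := U))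
    ⟨(frontier U).domRestrict l, continuousOn_iff_continuous_domRestrict.1 hl⟩
  have hgl : ∀ z ∈ frontier U, g z = l z := fun z hz => DFunLike.congr_fun hg ⟨z, hz⟩
  have hzp : ∀ z ∈ Uᶜ, toC z - toC p ≠ 0 := fun z hz => toC_sub_ne_zero_of_mem hz (by simpa)
  have hHc : Continuous fun z => if z ∈ closure U then Complex.exp (g z) / h z
      else (toC z - toC p) ^ k := by
    rw [← continuousOn_univ, show (univ : Set Plane) = closure U ∪ Uᶜ from
      (univ_subset_iff.1 fun z _ => (em (z ∈ U)).imp (fun h => subset_closure h) id).symm]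
    refine ContinuousOn.union_of_isClosed ?_ ?_ isClosed_closure hU.isClosed_compl
    · exact (((by fun_prop : Continuous fun z => Complex.exp (g z)).continuousOn).div hh h0).congr
        fun z hz => by simp [hz]
    · refine ((by fun_prop : Continuous fun z => toC z - toC p).continuousOn.zpow₀ k
        fun z hz => Or.inl (hzp z hz)).congr fun z hz => ?_
      by_cases hzU : z ∈ closure U
      · have hzf : z ∈ frontier U := ⟨hzU, by rwa [hU.interior_eq]⟩
        have := hle z hzf
        simp only [hzU, if_true, hgl z hzf, this]
        rw [mul_div_cancel_right₀ _ (h0 z hzU)]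
      · simp [hzU]
  obtain ⟨m, hm, hme⟩ := exists_continuous_log hHc fun z => by
    by_cases hz : z ∈ closure U
    · simp [hz, h0 z hz]
    · simp only [hz, if_false]
      exact zpow_ne_zero _ (hzp z fun h => hz (subset_closure h))
  obtain ⟨r, hr, hUr⟩ : ∃ r > 0, closure U ⊆ ball p r := by
    obtain ⟨r, hr⟩ := hb.closure.subset_ball_lt 0 p
    exact ⟨r, hr⟩
  let w : ℝ → Plane := fun t => toC.symm (toC p + r * Complex.exp (t * Complex.I))
  have hwc : Continuous w := toC.symm.continuous.comp (by fun_prop)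
  have hw : ∀ t, toC (w t) - toC p = r * Complex.exp (t * Complex.I) := fun t => by simp [w]
  have hwU : ∀ t, w t ∉ closure U := by
    intro t ht
    have h1 := hUr ht
    rw [mem_ball, ← toC.dist_map, dist_eq_norm, hw, norm_mul, Complex.norm_exp_ofReal_mul_I] at h1
    simp [abs_of_pos hr] at h1
  have hd : ContinuousOn (fun t : ℝ => m (w t) - k * (t * Complex.I + Complex.log r)) univ := by
    exact (by fun_prop : Continuous _).continuousOn
  have h2 := eq_const_of_exp_eq isPreconnected_univ hd (fun t _ => by
    have h4 := hme (w t)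
    simp only [if_neg (hwU t)] at h4
    rw [Complex.exp_sub, h4, hw, Complex.exp_int_mul,
      Complex.exp_add, Complex.exp_log (by exact_mod_cast hr.ne'), mul_comm, div_self]
    exact zpow_ne_zero _ (mul_ne_zero (Complex.exp_ne_zero _) (by exact_mod_cast hr.ne')))
    0 (mem_univ _) (2 * Real.pi) (mem_univ _)
  have hw0 : w (2 * Real.pi) = w 0 := by simp [w, Complex.exp_two_pi_mul_I]
  rw [hw0] at h2
  have h3 : (k : ℂ) * (2 * Real.pi * Complex.I) = 0 := by
    push_cast at h2
    linear_combination h2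
  simpa [Complex.two_pi_I_ne_zero, Real.pi_ne_zero] using h3

/-- `p` and `q` are not separated by `X`, in Eilenberg's form. -/
def Sim (X : Set Plane) (p q : Plane) : Prop :=
  HasLog X (fun z => (toC z - toC p) / (toC z - toC q))

lemma Sim.symm {X : Set Plane} {p q : Plane} (h : Sim X p q) : Sim X q p :=
  (HasLog.inv h).congr fun z _ => by simp

lemma Sim.trans {X : Set Plane} {p q r : Plane} (hq : q ∉ X) (h : Sim X p q) (h' : Sim X q r) :
    Sim X p r :=
  (HasLog.mul h h').congr fun z hz => by
    rw [div_mul_div_cancel₀ (toC_sub_ne_zero_of_mem hz hq)]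

lemma sim_of_isPreconnected {X S : Set Plane} (hX : IsClosed X) (hS : IsPreconnected S)
    (hSX : Disjoint S X) {p q : Plane} (hp : p ∈ S) (hq : q ∈ S) : Sim X p q := by
  have hn : ∀ x ∈ S, x ∉ X := fun x hx hx' => hSX.notMem_of_mem_left hx hx'
  refine hS.induction₂ (Sim X) (fun x hx => ?_) (fun x y z _ hy _ h h' => h.trans (hn y hy) h')
    (fun x y _ _ h => h.symm) hp hq
  obtain ⟨r, hr, hball⟩ := Metric.isOpen_iff.1 hX.isOpen_compl x (hn x hx)
  refine Filter.Eventually.filter_mono nhdsWithin_le_nhds ?_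
  filter_upwards [ball_mem_nhds x (half_pos hr)] with y hy
  have hyX : y ∉ X := fun h => hball (ball_subset_ball (half_le_self hr.le) hy) h
  have hs : ∀ z ∈ X, (toC z - toC x) / (toC z - toC y) ∈ Complex.slitPlane := by
    intro z hz
    have hne := toC_sub_ne_zero_of_mem hz hyX
    have e : (toC z - toC x) / (toC z - toC y) = 1 + (toC y - toC x) / (toC z - toC y) := by
      field_simp
      ring
    rw [e]
    apply Complex.mem_slitPlane_of_norm_lt_one
    have h1 : r ≤ dist z x := by
      by_contra h
      exact hball (mem_ball.2 (not_le.1 h)) hz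
    rw [norm_div, div_lt_one (norm_pos_iff.2 hne), ← dist_eq_norm, ← dist_eq_norm,
      toC.dist_map, toC.dist_map]
    have h2 := mem_ball.1 hy
    have h3 := dist_triangle z y x
    linarith
  refine ⟨fun z => Complex.log ((toC z - toC x) / (toC z - toC y)), ?_, fun z hz =>
    Complex.exp_log (Complex.slitPlane_ne_zero (hs z hz))⟩
  refine ContinuousOn.clog (ContinuousOn.div (by fun_prop) (by fun_prop)
    fun z hz => toC_sub_ne_zero_of_mem hz hyX) hs

lemma Acyclic.sim {X : Set Plane} (hX : Acyclic X) {p q : Plane} (hp : p ∉ X) (hq : q ∉ X) :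
    Sim X p q := by
  refine hX _ ?_ fun z hz => div_ne_zero (toC_sub_ne_zero_of_mem hz hp)
    (toC_sub_ne_zero_of_mem hz hq)
  exact ContinuousOn.div (by fun_prop) (by fun_prop) fun z hz => toC_sub_ne_zero_of_mem hz hq

/-- The union of the bounded components of the complement of `J`. -/
def inn (J : Set Plane) : Set Plane :=
  {p | p ∉ J ∧ Bornology.IsBounded (connectedComponentIn Jᶜ p)}

lemma frontier_component_subset {X : Set Plane} (hX : IsClosed X) (p : Plane) :
    frontier (connectedComponentIn Xᶜ p) ⊆ X := by
  intro z hz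
  by_contra hzX
  have hop : IsOpen (connectedComponentIn Xᶜ p) := hX.isOpen_compl.connectedComponentIn
  have hmem : z ∈ connectedComponentIn Xᶜ z := mem_connectedComponentIn hzX
  obtain ⟨w, hw1, hw2⟩ := mem_closure_iff.1 hz.1 _ hX.isOpen_compl.connectedComponentIn hmem
  rw [connectedComponentIn_eq hw1, ← connectedComponentIn_eq hw2] at hmem
  exact hz.2 (hop.interior_eq.symm ▸ hmem)

lemma closure_component_subset {X : Set Plane} (hX : IsClosed X) (p : Plane) :
    closure (connectedComponentIn Xᶜ p) ⊆ connectedComponentIn Xᶜ p ∪ X := by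
  rw [closure_eq_self_union_frontier]
  exact union_subset_union_right _ (frontier_component_subset hX p)

lemma one_lt_rank_plane : 1 < Module.rank ℝ Plane := by
  rw [← Module.finrank_eq_rank]
  simp

lemma isPreconnected_norm_gt {r : ℝ} (hr : 0 ≤ r) : IsPreconnected {z : Plane | r < ‖z‖} := by
  have h : {z : Plane | r < ‖z‖} =
      (fun a : ℝ × Plane => a.1 • a.2) '' (Ioi r ×ˢ sphere (0 : Plane) 1) := by
    ext z
    constructor
    · intro hz
      have hz0 : 0 < ‖z‖ := hr.trans_lt hz
      exact ⟨(‖z‖, ‖z‖⁻¹ • z), ⟨hz, by simp [norm_smul, hz0.ne']⟩, by simp [smul_smul, hz0.ne']⟩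
    · rintro ⟨⟨t, w⟩, ⟨ht, hw⟩, rfl⟩
      have ht' : r < t := ht
      have hw' : ‖w‖ = 1 := by simpa using hw
      simp only [mem_ofPred_eq, norm_smul, hw', mul_one, Real.norm_eq_abs]
      exact ht'.trans_le (le_abs_self t)
  rw [h]
  exact (isPreconnected_Ioi.prod (isPreconnected_sphere one_lt_rank_plane 0 1)).image _
    (by fun_prop : Continuous _).continuousOn

lemma mem_component_of_not_isBounded {X : Set Plane} (hX : Bornology.IsBounded X) {p q : Plane}
    (hp : ¬ Bornology.IsBounded (connectedComponentIn Xᶜ p))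
    (hq : ¬ Bornology.IsBounded (connectedComponentIn Xᶜ q)) : q ∈ connectedComponentIn Xᶜ p := by
  obtain ⟨r, hr, hXr⟩ := hX.subset_ball_lt 0 0
  have hW : {z : Plane | r < ‖z‖} ⊆ Xᶜ := fun z hz hzX => by
    have := hXr hzX
    rw [mem_ball_zero_iff] at this
    exact lt_asymm this hz
  have key : ∀ p : Plane, ¬ Bornology.IsBounded (connectedComponentIn Xᶜ p) →
      {z : Plane | r < ‖z‖} ⊆ connectedComponentIn Xᶜ p := by
    intro p hp
    obtain ⟨z, hz, hzr⟩ : ∃ z ∈ connectedComponentIn Xᶜ p, r < ‖z‖ := by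
      by_contra! h
      exact hp ((isBounded_closedBall (x := (0 : Plane)) (r := r)).subset fun z hz => by
        simpa using h z hz)
    rw [connectedComponentIn_eq hz]
    exact (isPreconnected_norm_gt hr.le).subset_connectedComponentIn hzr hW
  obtain ⟨z, hz, hzr⟩ : ∃ z ∈ connectedComponentIn Xᶜ q, r < ‖z‖ := by
    by_contra! h
    exact hq ((isBounded_closedBall (x := (0 : Plane)) (r := r)).subset fun z hz => by
      simpa using h z hz)
  rw [connectedComponentIn_eq (key p hp hzr), ← connectedComponentIn_eq hz]
  exact mem_connectedComponentIn (connectedComponentIn_nonempty_iff.1 ⟨z, hz⟩)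

/-- Eilenberg's criterion. -/
lemma Sim.mem_component {X : Set Plane} (hX : IsCompact X) {p q : Plane} (hp : p ∉ X) (hq : q ∉ X)
    (h : Sim X p q) : q ∈ connectedComponentIn Xᶜ p := by
  have main : ∀ p q : Plane, p ∉ X → q ∉ X → Sim X p q →
      Bornology.IsBounded (connectedComponentIn Xᶜ p) → q ∈ connectedComponentIn Xᶜ p := by
    intro p q hp hq h hb
    by_contra hqp
    have hqc : q ∉ closure (connectedComponentIn Xᶜ p) := fun h' =>
      (closure_component_subset hX.isClosed p h').elim hqp hq
    have := exponent_eq_zero hX.isClosed.isOpen_compl.connectedComponentIn hb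
      (mem_connectedComponentIn hp) (k := 1) (h := fun z => (toC z - toC q)⁻¹)
      (ContinuousOn.inv₀ (by fun_prop) fun z hz => toC_sub_ne_zero_of_mem hz hqc)
      (fun z hz => inv_ne_zero (toC_sub_ne_zero_of_mem hz hqc))
      ((HasLog.mono h (frontier_component_subset hX.isClosed p)).congr fun z _ => by
        simp [div_eq_mul_inv])
    exact one_ne_zero this
  by_cases hbp : Bornology.IsBounded (connectedComponentIn Xᶜ p)
  · exact main p q hp hq h hbp
  · by_cases hbq : Bornology.IsBounded (connectedComponentIn Xᶜ q)
    · have := main q p hq hp h.symm hbq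
      rw [← connectedComponentIn_eq this]
      exact mem_connectedComponentIn hq
    · exact mem_component_of_not_isBounded hX.isBounded hbp hbq

/-- `S` is an arc from `x` to `y`. -/
def IsArc (S : Set Plane) (x y : Plane) : Prop :=
  ∃ (a b : ℝ) (f : ℝ → Plane), a < b ∧ ContinuousOn f (Icc a b) ∧ InjOn f (Icc a b) ∧
    f a = x ∧ f b = y ∧ f '' Icc a b = S

namespace IsArc

variable {S S' : Set Plane} {x y z : Plane}

lemma symm (h : IsArc S x y) : IsArc S y x := by
  obtain ⟨a, b, f, hab, hc, hi, rfl, rfl, rfl⟩ := h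
  have hm : MapsTo (fun t : ℝ => -t) (Icc (-b) (-a)) (Icc a b) := fun t ht =>
    ⟨by linarith [ht.2], by linarith [ht.1]⟩
  refine ⟨-b, -a, fun t => f (-t), neg_lt_neg hab, hc.comp (by fun_prop) hm, ?_, by simp, by simp,
    ?_⟩
  · intro s hs t ht hst
    exact neg_injective (hi (hm hs) (hm ht) hst)
  · rw [← image_image f (fun t => -t), image_neg_eq_neg, neg_Icc, neg_neg, neg_neg]

lemma isCompact (h : IsArc S x y) : IsCompact S := by
  obtain ⟨a, b, f, hab, hc, hi, rfl, rfl, rfl⟩ := h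
  exact isCompact_Icc.image_of_continuousOn hc

lemma isClosed (h : IsArc S x y) : IsClosed S := h.isCompact.isClosed

lemma isPreconnected (h : IsArc S x y) : IsPreconnected S := by
  obtain ⟨a, b, f, hab, hc, hi, rfl, rfl, rfl⟩ := h
  exact isPreconnected_Icc.image f hc

lemma left_mem (h : IsArc S x y) : x ∈ S := by
  obtain ⟨a, b, f, hab, hc, hi, rfl, rfl, rfl⟩ := h
  exact mem_image_of_mem f (left_mem_Icc.2 hab.le)

lemma right_mem (h : IsArc S x y) : y ∈ S := h.symm.left_mem

lemma ne (h : IsArc S x y) : x ≠ y := by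
  obtain ⟨a, b, f, hab, hc, hi, rfl, rfl, rfl⟩ := h
  exact fun h => hab.ne (hi (left_mem_Icc.2 hab.le) (right_mem_Icc.2 hab.le) h)

lemma isPreconnected_diff_left (h : IsArc S x y) : IsPreconnected (S \ {x}) := by
  obtain ⟨a, b, f, hab, hc, hi, rfl, rfl, rfl⟩ := h
  have : f '' Icc a b \ {f a} = f '' Ioc a b := by
    rw [← image_singleton, ← hi.image_sdiff_subset (by simpa using hab.le), Icc_sdiff_left]
  rw [this]
  exact isPreconnected_Ioc.image f (hc.mono Ioc_subset_Icc_self)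

lemma exists_diff_eq (h : IsArc S x y) : ∃ (a b : ℝ) (f : ℝ → Plane), a < b ∧
    ContinuousOn f (Icc a b) ∧ S = f '' Icc a b ∧ S \ {x, y} = f '' Ioo a b := by
  obtain ⟨a, b, f, hab, hc, hi, rfl, rfl, rfl⟩ := h
  refine ⟨a, b, f, hab, hc, rfl, ?_⟩
  rw [← image_pair, ← hi.image_sdiff_subset (by
    rintro t (rfl | rfl)
    · exact left_mem_Icc.2 hab.le
    · exact right_mem_Icc.2 hab.le), Icc_sdiff_both]

lemma isPreconnected_interior (h : IsArc S x y) : IsPreconnected (S \ {x, y}) := by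
  obtain ⟨a, b, f, hab, hc, -, h⟩ := h.exists_diff_eq
  rw [h]
  exact isPreconnected_Ioo.image f (hc.mono Ioo_subset_Icc_self)

lemma interior_nonempty (h : IsArc S x y) : (S \ {x, y}).Nonempty := by
  obtain ⟨a, b, f, hab, hc, -, h⟩ := h.exists_diff_eq
  rw [h]
  exact (nonempty_Ioo.2 hab).image f

lemma subset_closure_interior (h : IsArc S x y) : S ⊆ closure (S \ {x, y}) := by
  obtain ⟨a, b, f, hab, hc, hS, h⟩ := h.exists_diff_eq
  rw [h, hS, ← closure_Ioo hab.ne]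
  rw [← closure_Ioo hab.ne] at hc
  exact hc.image_closure

lemma acyclic (h : IsArc S x y) : Acyclic S := by
  obtain ⟨a, b, f, hab, hc, hi, rfl, rfl, rfl⟩ := h
  intro g hg h0
  have hpm : ∀ t, (projIcc a b hab.le t : ℝ) ∈ Icc a b := fun t => (projIcc a b hab.le t).2
  have hcont : Continuous fun t => g (f (projIcc a b hab.le t)) := by
    have h1 : Continuous fun t : ℝ => f (projIcc a b hab.le t) :=
      hc.comp_continuous (by fun_prop) hpm
    exact hg.comp_continuous h1 fun t => mem_image_of_mem f (hpm t)
  obtain ⟨l, hl, hle⟩ := exists_continuous_log hcont fun t => h0 _ (mem_image_of_mem f (hpm t))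
  have hinv : ContinuousOn (Function.invFunOn f (Icc a b)) (f '' Icc a b) := by
    rw [continuousOn_iff_isClosed]
    intro t ht
    refine ⟨f '' (t ∩ Icc a b), ((isCompact_Icc.inter_left ht).image_of_continuousOn
      (hc.mono inter_subset_right)).isClosed, ?_⟩
    ext w
    constructor
    · rintro ⟨h1, s, hs, rfl⟩
      refine ⟨⟨s, ⟨?_, hs⟩, rfl⟩, s, hs, rfl⟩
      have : Function.invFunOn f (Icc a b) (f s) ∈ t := h1
      rwa [hi.leftInvOn_invFunOn hs] at this
    · rintro ⟨⟨s, ⟨hst, hs⟩, rfl⟩, -⟩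
      refine ⟨?_, s, hs, rfl⟩
      change Function.invFunOn f (Icc a b) (f s) ∈ t
      rwa [hi.leftInvOn_invFunOn hs]
  refine ⟨l ∘ Function.invFunOn f (Icc a b), hl.comp_continuousOn hinv, ?_⟩
  rintro _ ⟨s, hs, rfl⟩
  simp only [Function.comp_apply]
  rw [hi.leftInvOn_invFunOn hs, hle, projIcc_of_mem hab.le hs]

lemma of_Icc {a b c d : ℝ} {f : ℝ → Plane} (hc : ContinuousOn f (Icc a b))
    (hi : InjOn f (Icc a b)) (hac : a ≤ c) (hcd : c < d) (hdb : d ≤ b) :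
    IsArc (f '' Icc c d) (f c) (f d) :=
  ⟨c, d, f, hcd, hc.mono (Icc_subset_Icc hac hdb), hi.mono (Icc_subset_Icc hac hdb), rfl, rfl, rfl⟩

lemma split (h : IsArc S x y) (hz : z ∈ S) (hzx : z ≠ x) (hzy : z ≠ y) :
    ∃ S₁ S₂, IsArc S₁ x z ∧ IsArc S₂ z y ∧ S₁ ∪ S₂ = S ∧ S₁ ∩ S₂ = {z} := by
  obtain ⟨a, b, f, hab, hc, hi, rfl, rfl, rfl⟩ := h
  obtain ⟨c, hcab, rfl⟩ := hz
  have hac : a < c := hcab.1.lt_of_ne fun h => hzx (by rw [h])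
  have hcb : c < b := hcab.2.lt_of_ne fun h => hzy (by rw [h])
  refine ⟨f '' Icc a c, f '' Icc c b, of_Icc hc hi le_rfl hac hcb.le,
    of_Icc hc hi hac.le hcb le_rfl, ?_, ?_⟩
  · rw [← image_union, Icc_union_Icc_eq_Icc hac.le hcb.le]
  · rw [← hi.image_inter (Icc_subset_Icc_right hcb.le) (Icc_subset_Icc_left hac.le),
      Icc_inter_Icc_eq_singleton hac.le hcb.le, image_singleton]

lemma concat (h : IsArc S x y) (h' : IsArc S' y z) (hi : S ∩ S' = {y}) : IsArc (S ∪ S') x z := by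
  classical
  obtain ⟨a, b, f, hab, hf, hfi, rfl, rfl, rfl⟩ := h
  obtain ⟨c, d, g, hcd, hg, hgi, hgf, rfl, rfl⟩ := h'
  have hm : MapsTo (fun t : ℝ => t - b + c) (Icc b (b + (d - c))) (Icc c d) := fun t ht =>
    ⟨by linarith [ht.1], by linarith [ht.2]⟩
  have hgc : ContinuousOn (fun t => g (t - b + c)) (Icc b (b + (d - c))) :=
    hg.comp (by fun_prop) hm
  have hgI : InjOn (fun t => g (t - b + c)) (Icc b (b + (d - c))) := fun s hs t ht hst => by
    have := hgi (hm hs) (hm ht) hst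
    linarith
  have himg : (fun t => g (t - b + c)) '' Icc b (b + (d - c)) = g '' Icc c d := by
    rw [← image_image g]
    congr 1
    ext t
    constructor
    · rintro ⟨s, hs, rfl⟩
      exact hm hs
    · intro ht
      exact ⟨t - c + b, ⟨by linarith [ht.1], by linarith [ht.2]⟩, by ring⟩
  set G := fun t => g (t - b + c) with hG
  have hGb : G b = f b := by simp [hG, hgf]
  set H := fun t => if t ≤ b then f t else G t with hH
  have hHf : EqOn H f (Icc a b) := fun t ht => by simp [hH, ht.2]
  have hHG : EqOn H G (Icc b (b + (d - c))) := fun t ht => by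
    by_cases h : t ≤ b
    · have : t = b := le_antisymm h ht.1
      simp [hH, this, hGb]
    · simp [hH, h]
  have hbe : b ≤ b + (d - c) := by linarith
  have hU : Icc a (b + (d - c)) = Icc a b ∪ Icc b (b + (d - c)) :=
    (Icc_union_Icc_eq_Icc hab.le hbe).symm
  rw [← himg] at hi ⊢
  refine ⟨a, b + (d - c), H, by linarith, ?_, ?_, ?_, ?_, ?_⟩
  · rw [hU]
    exact (hf.congr hHf).union_of_isClosed (hgc.congr hHG) isClosed_Icc isClosed_Icc
  · have key : ∀ s ∈ Icc a b, ∀ t ∈ Icc b (b + (d - c)), f s = G t → s = t := by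
      intro s hs t ht hst
      have h1 : f s ∈ ({f b} : Set Plane) := hi ▸ ⟨⟨s, hs, rfl⟩, ⟨t, ht, hst.symm⟩⟩
      have h2 : s = b := hfi hs (right_mem_Icc.2 hab.le) h1
      have h3 : t = b := hgI ht (left_mem_Icc.2 hbe) (by
        rw [← hst, h1, hGb])
      rw [h2, h3]
    rw [hU]
    rintro s (hs | hs) t (ht | ht) hst
    · rw [hHf hs, hHf ht] at hst
      exact hfi hs ht hst
    · rw [hHf hs, hHG ht] at hst
      exact key s hs t ht hst
    · rw [hHG hs, hHf ht] at hst
      exact (key t ht s hs hst.symm).symm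
    · rw [hHG hs, hHG ht] at hst
      exact hgI hs ht hst
  · exact hHf (left_mem_Icc.2 hab.le)
  · rw [hHG (right_mem_Icc.2 hbe)]
    simp [hG]
  · rw [hU, image_union, hHf.image_eq, hHG.image_eq]

/-- Following an arc until it first meets a closed set. -/
lemma exists_first_hit (h : IsArc S x y) {F : Set Plane} (hF : IsClosed F) (hy : y ∈ F)
    (hx : x ∉ F) : ∃ z S₁, z ∈ F ∧ IsArc S₁ x z ∧ S₁ ⊆ S ∧ S₁ ∩ F = {z} ∧
      ((z = y ∧ S₁ = S) ∨ ∃ S₂, IsArc S₂ z y ∧ S₁ ∪ S₂ = S ∧ S₁ ∩ S₂ = {z}) := by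
  obtain ⟨a, b, f, hab, hc, hi, rfl, rfl, rfl⟩ := h
  have hcl : IsClosed (Icc a b ∩ f ⁻¹' F) := hc.preimage_isClosed_of_isClosed isClosed_Icc hF
  obtain ⟨c, ⟨hcab, hcF⟩, hmin⟩ := (isCompact_Icc.of_isClosed_subset hcl
    inter_subset_left).exists_isLeast ⟨b, right_mem_Icc.2 hab.le, hy⟩
  have hac : a < c := hcab.1.lt_of_ne fun h => hx (by rwa [h])
  refine ⟨f c, f '' Icc a c, hcF, of_Icc hc hi le_rfl hac hcab.2,
    image_mono (Icc_subset_Icc_right hcab.2), ?_, ?_⟩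
  · apply Subset.antisymm
    · rintro _ ⟨⟨t, ht, rfl⟩, htF⟩
      have := hmin ⟨⟨ht.1, ht.2.trans hcab.2⟩, htF⟩
      rw [le_antisymm ht.2 this]
      rfl
    · rintro _ rfl
      exact ⟨⟨c, right_mem_Icc.2 hac.le, rfl⟩, hcF⟩
  · rcases hcab.2.eq_or_lt with rfl | hcb
    · exact Or.inl ⟨rfl, rfl⟩
    · refine Or.inr ⟨f '' Icc c b, of_Icc hc hi hac.le hcb le_rfl, ?_, ?_⟩
      · rw [← image_union, Icc_union_Icc_eq_Icc hac.le hcb.le]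
      · rw [← hi.image_inter (Icc_subset_Icc_right hcb.le) (Icc_subset_Icc_left hac.le),
          Icc_inter_Icc_eq_singleton hac.le hcb.le, image_singleton]

end IsArc

/-- Removing a small piece around an interior point of an arc. -/
lemma IsArc.exists_gap {S N : Set Plane} {x y w : Plane} (h : IsArc S x y) (hw : w ∈ S \ {x, y})
    (hN : N ∈ nhds w) : ∃ u v S₁ S₂, IsArc S₁ x u ∧ IsArc S₂ v y ∧ Disjoint S₁ S₂ ∧ S₁ ⊆ S ∧
      S₂ ⊆ S ∧ S ⊆ S₁ ∪ S₂ ∪ N := by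
  obtain ⟨a, b, f, hab, hc, hi, rfl, rfl, rfl⟩ := h
  obtain ⟨⟨t, ht, rfl⟩, hne⟩ := hw
  have hat : a < t := ht.1.lt_of_ne fun h => hne (by simp [h])
  have htb : t < b := ht.2.lt_of_ne fun h => hne (by simp [h])
  have hct : ContinuousAt f t := hc.continuousAt (Icc_mem_nhds hat htb)
  obtain ⟨c, d, htcd, hcd⟩ := mem_nhds_iff_exists_Ioo_subset.1 (hct hN)
  obtain ⟨c', hc1, hc2⟩ := exists_between (max_lt hat htcd.1)
  obtain ⟨d', hd1, hd2⟩ := exists_between (lt_min htb htcd.2)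
  rw [max_lt_iff] at hc1
  rw [lt_min_iff] at hd2
  have hcd' := hc2.trans hd1
  refine ⟨f c', f d', f '' Icc a c', f '' Icc d' b,
    of_Icc hc hi le_rfl hc1.1 (hcd'.le.trans hd2.1.le),
    of_Icc hc hi (hc1.1.le.trans hcd'.le) hd2.1 le_rfl, ?_,
    image_mono (Icc_subset_Icc_right (hcd'.le.trans hd2.1.le)),
    image_mono (Icc_subset_Icc_left (hc1.1.le.trans hcd'.le)), ?_⟩
  · rw [disjoint_left]
    rintro _ ⟨s, hs, rfl⟩ ⟨r, hr, hrs⟩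
    have := hi ⟨(hc1.1.le.trans hcd'.le).trans hr.1, hr.2⟩
      ⟨hs.1, hs.2.trans (hcd'.le.trans hd2.1.le)⟩ hrs
    linarith [hs.2, hr.1]
  · rintro _ ⟨s, hs, rfl⟩
    by_cases h1 : s ≤ c'
    · exact Or.inl (Or.inl ⟨s, ⟨hs.1, h1⟩, rfl⟩)
    · by_cases h2 : d' ≤ s
      · exact Or.inl (Or.inr ⟨s, ⟨h2, hs.2⟩, rfl⟩)
      · exact Or.inr (hcd ⟨hc1.2.trans (not_le.1 h1), (not_le.1 h2).trans hd2.2⟩)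

lemma exists_not_isBounded_component {X : Set Plane} (hX : Bornology.IsBounded X) :
    ∃ q ∉ X, ¬ Bornology.IsBounded (connectedComponentIn Xᶜ q) := by
  obtain ⟨r, hr, hXr⟩ := hX.subset_ball_lt 0 0
  have hW : {z : Plane | r < ‖z‖} ⊆ Xᶜ := fun z hz hzX => by
    have := hXr hzX
    rw [mem_ball_zero_iff] at this
    exact lt_asymm this hz
  have hun : ∀ s : ℝ, ∃ z : Plane, s < ‖z‖ := fun s => by
    obtain ⟨z, hz⟩ := NormedSpace.exists_lt_norm ℝ Plane s
    exact ⟨z, hz⟩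
  obtain ⟨q, hq⟩ := hun r
  refine ⟨q, hW hq, fun hb => ?_⟩
  obtain ⟨s, hs⟩ := hb.subset_ball 0
  obtain ⟨z, hz⟩ := hun (max r s)
  have h1 := hs ((isPreconnected_norm_gt hr.le).subset_connectedComponentIn hq hW
    ((le_max_left _ _).trans_lt hz))
  rw [mem_ball_zero_iff] at h1
  exact lt_asymm h1 ((le_max_right _ _).trans_lt hz)

/-- Two arcs from `x` to `y` that meet only in their endpoints. -/
structure IsLoop (Q R : Set Plane) (x y : Plane) : Prop where
  left : IsArc Q x y
  right : IsArc R x y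
  inter : Q ∩ R = {x, y}

/-- `f` winds `d` times around zero along the loop formed by `Q` and `R`. -/
def Winds (Q R : Set Plane) (x y : Plane) (f : Plane → ℂ) (d : ℤ) : Prop :=
  ∃ l m : Plane → ℂ, ContinuousOn l Q ∧ ContinuousOn m R ∧ (∀ z ∈ Q, Complex.exp (l z) = f z) ∧
    (∀ z ∈ R, Complex.exp (m z) = f z) ∧ (l y - m y) - (l x - m x) = d * (2 * Real.pi * Complex.I)

lemma Winds.mul_zpow {Q R : Set Plane} {x y : Plane} {f g : Plane → ℂ} {d e : ℤ}
    (hf : Winds Q R x y f d) (hg : Winds Q R x y g e) (j k : ℤ) :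
    Winds Q R x y (fun z => f z ^ j * g z ^ k) (j * d + k * e) := by
  obtain ⟨l, m, hl, hm, hle, hme, h⟩ := hf
  obtain ⟨l', m', hl', hm', hle', hme', h'⟩ := hg
  refine ⟨fun z => j * l z + k * l' z, fun z => j * m z + k * m' z, by fun_prop, by fun_prop,
    fun z hz => ?_, fun z hz => ?_, ?_⟩
  · rw [Complex.exp_add, Complex.exp_int_mul, Complex.exp_int_mul, hle z hz, hle' z hz]
  · rw [Complex.exp_add, Complex.exp_int_mul, Complex.exp_int_mul, hme z hz, hme' z hz]
  · push_cast
    linear_combination (j : ℂ) * h + (k : ℂ) * h'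

namespace IsLoop

variable {Q R : Set Plane} {x y p q : Plane}

lemma symm (h : IsLoop Q R x y) : IsLoop R Q x y :=
  ⟨h.right, h.left, by rw [inter_comm, h.inter]⟩

lemma swap (h : IsLoop Q R x y) : IsLoop Q R y x :=
  ⟨h.left.symm, h.right.symm, by rw [h.inter, pair_comm]⟩

lemma isCompact (h : IsLoop Q R x y) : IsCompact (Q ∪ R) :=
  h.left.isCompact.union h.right.isCompact

lemma isClosed (h : IsLoop Q R x y) : IsClosed (Q ∪ R) := h.isCompact.isClosed

lemma exists_winds (h : IsLoop Q R x y) {f : Plane → ℂ} (hf : ContinuousOn f (Q ∪ R))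
    (h0 : ∀ z ∈ Q ∪ R, f z ≠ 0) : ∃ d, Winds Q R x y f d := by
  obtain ⟨l, hl, hle⟩ := h.left.acyclic f (hf.mono subset_union_left) fun z hz => h0 z (Or.inl hz)
  obtain ⟨m, hm, hme⟩ := h.right.acyclic f (hf.mono subset_union_right)
    fun z hz => h0 z (Or.inr hz)
  have key : ∀ z ∈ Q ∩ R, ∃ n : ℤ, l z - m z = n * (2 * Real.pi * Complex.I) := fun z hz =>
    Complex.exp_eq_one_iff.1 (by
      rw [Complex.exp_sub, hle z hz.1, hme z hz.2, div_self (h0 z (Or.inl hz.1))])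
  obtain ⟨i, hi⟩ := key x ⟨h.left.left_mem, h.right.left_mem⟩
  obtain ⟨j, hj⟩ := key y ⟨h.left.right_mem, h.right.right_mem⟩
  refine ⟨j - i, l, m, hl, hm, hle, hme, ?_⟩
  rw [hi, hj]
  push_cast
  ring

lemma hasLog (h : IsLoop Q R x y) {f : Plane → ℂ} (hf : Winds Q R x y f 0)
    (h0 : ∀ z ∈ Q ∪ R, f z ≠ 0) : HasLog (Q ∪ R) f := by
  classical
  obtain ⟨l, m, hl, hm, hle, hme, hd⟩ := hf
  set c := l x - m x with hc
  have hx := h.left.left_mem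
  have hx' := h.right.left_mem
  have hc1 : Complex.exp c = 1 := by
    rw [hc, Complex.exp_sub, hle x hx, hme x hx', div_self (h0 x (Or.inl hx))]
  have hR : EqOn (fun z => if z ∈ Q then l z else m z + c) (fun z => m z + c) R := by
    intro z hz
    by_cases hzQ : z ∈ Q
    · have : z ∈ ({x, y} : Set Plane) := h.inter ▸ ⟨hzQ, hz⟩
      simp only [hzQ, if_true]
      rcases this with rfl | rfl
      · rw [hc]
        ring
      · push_cast at hd
        linear_combination hd
    · simp [hzQ]
  have hQ : EqOn (fun z => if z ∈ Q then l z else m z + c) l Q := fun z hz => by simp [hz]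
  refine ⟨_, (hl.congr hQ).union_of_isClosed ((hm.add continuousOn_const).congr hR)
    h.left.isClosed h.right.isClosed, ?_⟩
  rintro z (hz | hz)
  · exact (congrArg Complex.exp (hQ hz)).trans (hle z hz)
  · refine (congrArg Complex.exp (hR hz)).trans ?_
    rw [Complex.exp_add, hc1, mul_one, hme z hz]

lemma mem_component (h : IsLoop Q R x y) (hp : p ∈ inn (Q ∪ R)) (hq : q ∈ inn (Q ∪ R)) :
    q ∈ connectedComponentIn (Q ∪ R)ᶜ p := by
  by_contra hqp
  have hne : ∀ w ∉ Q ∪ R, ∀ z ∈ Q ∪ R, toC z - toC w ≠ 0 := fun w hw z hz =>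
    toC_sub_ne_zero_of_mem hz hw
  have hqc : q ∉ closure (connectedComponentIn (Q ∪ R)ᶜ p) := fun h' =>
    (closure_component_subset h.isClosed p h').elim hqp hq.1
  obtain ⟨d, hd⟩ := h.exists_winds (f := fun z => toC z - toC p) (by fun_prop) (hne p hp.1)
  obtain ⟨e, he⟩ := h.exists_winds (f := fun z => toC z - toC q) (by fun_prop) (hne q hq.1)
  have hw := hd.mul_zpow he e (-d)
  rw [show e * d + -d * e = 0 by ring] at hw
  have he0 : e = 0 := exponent_eq_zero h.isClosed.isOpen_compl.connectedComponentIn hp.2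
    (mem_connectedComponentIn hp.1) (h := fun z => (toC z - toC q) ^ (-d))
    (ContinuousOn.zpow₀ (by fun_prop) _ fun z hz => Or.inl (toC_sub_ne_zero_of_mem hz hqc))
    (fun z hz => zpow_ne_zero _ (toC_sub_ne_zero_of_mem hz hqc))
    ((h.hasLog hw fun z hz => mul_ne_zero (zpow_ne_zero _ (hne p hp.1 z hz))
      (zpow_ne_zero _ (hne q hq.1 z hz))).mono (frontier_component_subset h.isClosed p))
  rw [he0] at he
  exact one_ne_zero (exponent_eq_zero h.isClosed.isOpen_compl.connectedComponentIn hq.2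
    (mem_connectedComponentIn hq.1) (k := 1) (h := fun _ => 1) continuousOn_const
    (fun _ _ => one_ne_zero) (((h.hasLog he (hne q hq.1)).mono
      (frontier_component_subset h.isClosed q)).congr fun z _ => by simp))

lemma left_subset_closure_component (h : IsLoop Q R x y) (hp : p ∉ Q ∪ R) (hq : q ∉ Q ∪ R)
    (hpq : q ∉ connectedComponentIn (Q ∪ R)ᶜ p) :
    Q ⊆ closure (connectedComponentIn (Q ∪ R)ᶜ p) := by
  refine h.left.subset_closure_interior.trans (closure_minimal ?_ isClosed_closure)
  intro w hw
  rw [_root_.mem_closure_iff]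
  intro N hN hwN
  obtain ⟨u, v, S₁, S₂, h1, h2, hd, hS1, hS2, hS⟩ := h.left.exists_gap hw (hN.mem_nhds hwN)
  have hyS1 : y ∉ S₁ := fun hy => hd.notMem_of_mem_left hy h2.right_mem
  have hxS2 : x ∉ S₂ := fun hx => hd.notMem_of_mem_left h1.left_mem hx
  have hi1 : S₁ ∩ R = {x} := by
    apply Subset.antisymm
    · rintro z ⟨hz, hzR⟩
      have : z ∈ ({x, y} : Set Plane) := h.inter ▸ ⟨hS1 hz, hzR⟩
      rcases this with rfl | rfl
      · rfl
      · exact absurd hz hyS1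
    · rintro _ rfl
      exact ⟨h1.left_mem, h.right.left_mem⟩
  have hi2 : (S₁ ∪ R) ∩ S₂ = {y} := by
    apply Subset.antisymm
    · rintro z ⟨hz | hzR, hz2⟩
      · exact absurd hz2 (hd.notMem_of_mem_left hz)
      have : z ∈ ({x, y} : Set Plane) := h.inter ▸ ⟨hS2 hz2, hzR⟩
      rcases this with rfl | rfl
      · exact absurd hz2 hxS2
      · rfl
    · rintro _ rfl
      exact ⟨Or.inr h.right.right_mem, h2.right_mem⟩
  set K := S₁ ∪ R ∪ S₂ with hKdef
  have hKc : IsCompact K := (h1.isCompact.union h.right.isCompact).union h2.isCompact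
  have hKa : Acyclic K := by
    refine Acyclic.union (h1.isClosed.union h.right.isClosed) h2.isClosed ?_
      (Acyclic.union h1.isClosed h.right.isClosed ?_ h1.acyclic h.right.acyclic) h2.acyclic
    · rw [hi2]
      exact isPreconnected_singleton
    · rw [hi1]
      exact isPreconnected_singleton
  have hKJ : K ⊆ Q ∪ R := union_subset (union_subset (hS1.trans subset_union_left)
    subset_union_right) (hS2.trans subset_union_left)
  have hJN : Q ∪ R ⊆ K ∪ N := by
    rintro z (hz | hz)
    · rcases hS hz with (hz | hz) | hz
      · exact Or.inl (Or.inl (Or.inl hz))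
      · exact Or.inl (Or.inr hz)
      · exact Or.inr hz
    · exact Or.inl (Or.inl (Or.inr hz))
  have hqK := (hKa.sim (fun h => hp (hKJ h)) fun h => hq (hKJ h)).mem_component hKc
    (fun h => hp (hKJ h)) fun h => hq (hKJ h)
  by_contra hcon
  refine hpq (isPreconnected_connectedComponentIn.subset_of_closure_inter_subset
    h.isClosed.isOpen_compl.connectedComponentIn
    ⟨p, mem_connectedComponentIn (show p ∈ Kᶜ from fun h => hp (hKJ h)), mem_connectedComponentIn hp⟩ ?_ hqK)
  rintro z ⟨hz, hzK⟩
  refine (closure_component_subset h.isClosed p hz).resolve_right fun hzJ => ?_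
  have hzN : z ∈ N := (hJN hzJ).resolve_left (connectedComponentIn_subset _ _ hzK)
  exact hcon (_root_.mem_closure_iff.1 hz N hN hzN)

lemma subset_closure_component (h : IsLoop Q R x y) (hp : p ∉ Q ∪ R) (hq : q ∉ Q ∪ R)
    (hpq : q ∉ connectedComponentIn (Q ∪ R)ᶜ p) :
    Q ∪ R ⊆ closure (connectedComponentIn (Q ∪ R)ᶜ p) := by
  refine union_subset (h.left_subset_closure_component hp hq hpq) ?_
  rw [union_comm] at hp hq hpq ⊢
  exact h.symm.left_subset_closure_component hp hq hpq

end IsLoop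

/-- `J` is the union of two arcs that meet only in their endpoints. -/
def IsSimpleClosed (J : Set Plane) : Prop := ∃ Q R x y, IsLoop Q R x y ∧ J = Q ∪ R

lemma IsLoop.isSimpleClosed {Q R : Set Plane} {x y : Plane} (h : IsLoop Q R x y) : IsSimpleClosed (Q ∪ R) :=
  ⟨Q, R, x, y, h, rfl⟩

namespace IsSimpleClosed

variable {J : Set Plane} {p q : Plane}

lemma isCompact (h : IsSimpleClosed J) : IsCompact J := by
  obtain ⟨Q, R, x, y, h, rfl⟩ := h
  exact h.isCompact

lemma isClosed (h : IsSimpleClosed J) : IsClosed J := h.isCompact.isClosed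

lemma inn_eq (h : IsSimpleClosed J) (hp : p ∈ inn J) : inn J = connectedComponentIn Jᶜ p := by
  apply Subset.antisymm
  · intro q hq
    obtain ⟨Q, R, x, y, h, rfl⟩ := h
    exact h.mem_component hp hq
  · intro q hq
    refine ⟨connectedComponentIn_subset _ _ hq, ?_⟩
    rw [← connectedComponentIn_eq hq]
    exact hp.2

lemma isOpen_inn (h : IsSimpleClosed J) : IsOpen (inn J) := by
  rcases (inn J).eq_empty_or_nonempty with he | ⟨p, hp⟩
  · simp [he]
  · rw [h.inn_eq hp]
    exact h.isClosed.isOpen_compl.connectedComponentIn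

lemma isPreconnected_inn (h : IsSimpleClosed J) : IsPreconnected (inn J) := by
  rcases (inn J).eq_empty_or_nonempty with he | ⟨p, hp⟩
  · simpa [he] using isPreconnected_empty
  · rw [h.inn_eq hp]
    exact isPreconnected_connectedComponentIn

lemma isBounded_inn (h : IsSimpleClosed J) : Bornology.IsBounded (inn J) := by
  rcases (inn J).eq_empty_or_nonempty with he | ⟨p, hp⟩
  · simp [he]
  · rw [h.inn_eq hp]
    exact hp.2

lemma subset_closure_inn (h : IsSimpleClosed J) (hne : (inn J).Nonempty) : J ⊆ closure (inn J) := by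
  obtain ⟨p, hp⟩ := hne
  obtain ⟨q, hq, hqb⟩ := exists_not_isBounded_component h.isCompact.isBounded
  have hqp : q ∉ connectedComponentIn Jᶜ p := fun h' => hqb (by
    rw [← connectedComponentIn_eq h']
    exact hp.2)
  rw [h.inn_eq hp]
  obtain ⟨Q, R, x, y, h, rfl⟩ := h
  exact h.subset_closure_component hp.1 hq hqp

lemma subset_closure_outside (h : IsSimpleClosed J) (hne : (inn J).Nonempty) :
    J ⊆ closure (J ∪ inn J)ᶜ := by
  obtain ⟨p, hp⟩ := hne
  obtain ⟨q, hq, hqb⟩ := exists_not_isBounded_component h.isCompact.isBounded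
  have hqp : p ∉ connectedComponentIn Jᶜ q := fun h' => hqb (by
    rw [connectedComponentIn_eq h']
    exact hp.2)
  have hsub : connectedComponentIn Jᶜ q ⊆ (J ∪ inn J)ᶜ := by
    rintro z hz (hzJ | hzi)
    · exact connectedComponentIn_subset _ _ hz hzJ
    · apply hqb
      rw [connectedComponentIn_eq hz]
      exact hzi.2
  refine Subset.trans ?_ (closure_mono hsub)
  obtain ⟨Q, R, x, y, h, rfl⟩ := h
  exact h.subset_closure_component hq hp.1 hqp

lemma closure_inn_subset (h : IsSimpleClosed J) : closure (inn J) ⊆ inn J ∪ J := by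
  rcases (inn J).eq_empty_or_nonempty with he | ⟨p, hp⟩
  · simp [he]
  · rw [h.inn_eq hp]
    exact closure_component_subset h.isClosed p

lemma frontier_inn (h : IsSimpleClosed J) (hne : (inn J).Nonempty) : frontier (inn J) = J := by
  rw [h.isOpen_inn.frontier_eq]
  apply Subset.antisymm
  · rintro z ⟨hz, hz'⟩
    exact (h.closure_inn_subset hz).resolve_left hz'
  · exact fun z hz => ⟨h.subset_closure_inn hne hz, fun hz' => hz'.1 hz⟩

lemma sim_iff (h : IsSimpleClosed J) (hp : p ∉ J) (hq : q ∉ J) :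
    Sim J p q ↔ (p ∈ inn J ↔ q ∈ inn J) := by
  constructor
  · intro hs
    have := connectedComponentIn_eq (hs.mem_component h.isCompact hp hq)
    simp only [inn, mem_ofPred_eq, hp, hq, this]
  · intro hpq
    have key : q ∈ connectedComponentIn Jᶜ p := by
      by_cases hpi : p ∈ inn J
      · rw [← h.inn_eq hpi]
        exact hpq.1 hpi
      · have hqi := fun h => hpi (hpq.2 h)
        exact mem_component_of_not_isBounded h.isCompact.isBounded (fun h => hpi ⟨hp, h⟩)
          fun h => hqi ⟨hq, h⟩
    exact sim_of_isPreconnected h.isClosed isPreconnected_connectedComponentIn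
      (disjoint_left.2 fun z hz => connectedComponentIn_subset _ _ hz)
      (mem_connectedComponentIn hp) key

end IsSimpleClosed

lemma Sim.union {X Y Z : Set Plane} {p q : Plane} (hX : IsClosed X) (hY : IsClosed Y)
    (hXY : IsPreconnected (X ∩ Y)) (h : Sim X p q) (h' : Sim Y p q) (hZ : Z ⊆ X ∪ Y) :
    Sim Z p q :=
  (HasLog.union hX hY hXY h h').mono hZ

namespace IsLoop

variable {P Q R : Set Plane} {x y : Plane}

/-- An arc through the inside of a loop joining its two base points forms a loop with either
side. -/
lemma crosscut (h : IsLoop Q R x y) (hP : IsArc P x y) (hPi : P \ {x, y} ⊆ inn (Q ∪ R)) :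
    IsLoop P Q x y := by
  refine ⟨hP, h.left, Subset.antisymm ?_ ?_⟩
  · rintro z ⟨hzP, hzQ⟩
    by_contra hz
    exact (hPi ⟨hzP, hz⟩).1 (Or.inl hzQ)
  · rintro z (rfl | rfl)
    · exact ⟨hP.left_mem, h.left.left_mem⟩
    · exact ⟨hP.right_mem, h.left.right_mem⟩

lemma crosscut_right (h : IsLoop Q R x y) (hP : IsArc P x y) (hPi : P \ {x, y} ⊆ inn (Q ∪ R)) :
    IsLoop P R x y :=
  h.symm.crosscut hP (by rwa [union_comm])

lemma crosscut_subset_union (h : IsLoop Q R x y) (hPi : P \ {x, y} ⊆ inn (Q ∪ R)) :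
    P ⊆ (Q ∪ R) ∪ inn (Q ∪ R) := by
  intro z hz
  by_cases hzx : z ∈ ({x, y} : Set Plane)
  · rcases hzx with rfl | rfl
    · exact Or.inl (Or.inl h.left.left_mem)
    · exact Or.inl (Or.inl h.left.right_mem)
  · exact Or.inr (hPi ⟨hz, hzx⟩)

lemma crosscut_nonempty (h : IsLoop Q R x y) (hP : IsArc P x y)
    (hPi : P \ {x, y} ⊆ inn (Q ∪ R)) : (inn (P ∪ Q)).Nonempty := by
  have hne := hP.interior_nonempty.mono hPi
  have hPQ := h.crosscut hP hPi
  obtain ⟨w, hwQ, hw⟩ := h.left.interior_nonempty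
  have hwPR : w ∈ (P ∪ R)ᶜ := by
    rintro (h' | h')
    · exact hw (hPQ.inter ▸ ⟨h', hwQ⟩)
    · exact hw (h.inter ▸ ⟨hwQ, h'⟩)
  obtain ⟨ε, hε, hball⟩ := Metric.isOpen_iff.1 (hP.isClosed.union h.right.isClosed).isOpen_compl
    w hwPR
  obtain ⟨p, hpb, hp⟩ := _root_.mem_closure_iff.1
    (h.isSimpleClosed.subset_closure_inn hne (Or.inl hwQ)) _ isOpen_ball (mem_ball_self hε)
  obtain ⟨q, hqb, hq⟩ := _root_.mem_closure_iff.1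
    (h.isSimpleClosed.subset_closure_outside hne (Or.inl hwQ)) _ isOpen_ball (mem_ball_self hε)
  have h1 : Sim (P ∪ R) p q := sim_of_isPreconnected (hP.isClosed.union h.right.isClosed)
    (convex_ball w ε).isPreconnected (disjoint_left.2 hball) hpb hqb
  have hqJ : q ∉ Q ∪ R := fun h => hq (Or.inl h)
  have hpP : p ∉ P ∪ Q := by
    rintro (h' | h')
    · exact hball hpb (Or.inl h')
    · exact hp.1 (Or.inl h')
  have hqP : q ∉ P ∪ Q := by
    rintro (h' | h')
    · exact hball hqb (Or.inl h')
    · exact hqJ (Or.inl h')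
  by_contra hcon
  rw [not_nonempty_iff_eq_empty] at hcon
  have h2 : Sim (P ∪ Q) p q := (hPQ.isSimpleClosed.sim_iff hpP hqP).2 (by simp [hcon])
  have hint : (P ∪ Q) ∩ (P ∪ R) = P := by
    rw [← union_inter_distrib_left, h.inter, union_eq_left]
    rintro z (rfl | rfl)
    exacts [hP.left_mem, hP.right_mem]
  have h3 : Sim (Q ∪ R) p q := Sim.union hPQ.isClosed (hP.isClosed.union h.right.isClosed)
    (by rw [hint]; exact hP.isPreconnected) h2 h1 (by
      rintro z (hz | hz)
      · exact Or.inl (Or.inr hz)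
      · exact Or.inr (Or.inr hz))
  exact hq (Or.inr (((h.isSimpleClosed.sim_iff hp.1 hqJ).1 h3).1 hp))

lemma crosscut_subset (h : IsLoop Q R x y) (hP : IsArc P x y)
    (hPi : P \ {x, y} ⊆ inn (Q ∪ R)) : inn (P ∪ Q) ⊆ inn (Q ∪ R) := by
  have hne := hP.interior_nonempty.mono hPi
  have hPQ := h.crosscut hP hPi
  have key : ∀ r ∈ inn (P ∪ Q), r ∈ (Q ∪ R) ∪ inn (Q ∪ R) := by
    intro r hr
    by_contra hcon
    refine hcon (Or.inr ⟨fun h => hcon (Or.inl h), hr.2.subset ?_⟩)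
    refine isPreconnected_connectedComponentIn.subset_connectedComponentIn
      (mem_connectedComponentIn fun h => hcon (Or.inl h)) ?_
    intro z hz
    have hzJ := connectedComponentIn_subset _ _ hz
    rintro (hzP | hzQ)
    · rcases h.crosscut_subset_union hPi hzP with h' | h'
      · exact hzJ h'
      · refine hcon (Or.inr ⟨fun h => hcon (Or.inl h), ?_⟩)
        rw [connectedComponentIn_eq hz]
        exact h'.2
    · exact hzJ (Or.inl hzQ)
  intro r hr
  refine (key r hr).resolve_left fun hrJ => ?_
  obtain ⟨z, hz, hz'⟩ := _root_.mem_closure_iff.1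
    (h.isSimpleClosed.subset_closure_outside hne hrJ) _ hPQ.isSimpleClosed.isOpen_inn hr
  exact hz' (key z hz)

lemma crosscut_cover (h : IsLoop Q R x y) (hP : IsArc P x y)
    (hPi : P \ {x, y} ⊆ inn (Q ∪ R)) : inn (Q ∪ R) ⊆ inn (P ∪ Q) ∪ inn (P ∪ R) ∪ P := by
  have hne := hP.interior_nonempty.mono hPi
  have hPQ := h.crosscut hP hPi
  have hPR := h.crosscut_right hP hPi
  have hsub' : inn (P ∪ R) ⊆ inn (Q ∪ R) := by
    rw [union_comm Q]
    exact h.symm.crosscut_subset hP (by rwa [union_comm])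
  intro z hz
  by_contra hcon
  simp only [mem_union, not_or] at hcon
  obtain ⟨⟨hz1, hz2⟩, hzP⟩ := hcon
  obtain ⟨q, -, hq⟩ := _root_.mem_closure_iff.1
    (h.isSimpleClosed.subset_closure_outside hne (Or.inl h.left.left_mem)) _ isOpen_univ
    (mem_univ _)
  have hqP : q ∉ P := fun h' => hq (h.crosscut_subset_union hPi h')
  have h1 : Sim (P ∪ Q) z q := (hPQ.isSimpleClosed.sim_iff
    (fun h' => h'.elim hzP fun h' => hz.1 (Or.inl h'))
    (fun h' => h'.elim hqP fun h' => hq (Or.inl (Or.inl h')))).2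
      (iff_of_false hz1 fun h' => hq (Or.inr (h.crosscut_subset hP hPi h')))
  have h2 : Sim (P ∪ R) z q := (hPR.isSimpleClosed.sim_iff
    (fun h' => h'.elim hzP fun h' => hz.1 (Or.inr h'))
    (fun h' => h'.elim hqP fun h' => hq (Or.inl (Or.inr h')))).2
      (iff_of_false hz2 fun h' => hq (Or.inr (hsub' h')))
  have hint : (P ∪ Q) ∩ (P ∪ R) = P := by
    rw [← union_inter_distrib_left, h.inter, union_eq_left]
    rintro z (rfl | rfl)
    exacts [hP.left_mem, hP.right_mem]
  have h3 : Sim (Q ∪ R) z q := Sim.union hPQ.isClosed hPR.isClosed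
    (by rw [hint]; exact hP.isPreconnected) h1 h2 (by
      rintro z (hz | hz)
      · exact Or.inl (Or.inr hz)
      · exact Or.inr (Or.inr hz))
  exact hq (Or.inr (((h.isSimpleClosed.sim_iff hz.1 fun h' => hq (Or.inl h')).1 h3).1 hz))

lemma crosscut_disjoint (h : IsLoop Q R x y) (hP : IsArc P x y)
    (hPi : P \ {x, y} ⊆ inn (Q ∪ R)) : Disjoint (inn (P ∪ Q)) (inn (P ∪ R)) := by
  have hPQ := h.crosscut hP hPi
  have hPR := h.crosscut_right hP hPi
  have hsub := h.crosscut_subset hP hPi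
  have hsub' : inn (P ∪ R) ⊆ inn (Q ∪ R) := by
    rw [union_comm Q]
    exact h.symm.crosscut_subset hP (by rwa [union_comm])
  rw [disjoint_left]
  intro z hz hz'
  have h1 : inn (P ∪ Q) ⊆ inn (P ∪ R) := by
    rw [hPR.isSimpleClosed.inn_eq hz']
    exact hPQ.isSimpleClosed.isPreconnected_inn.subset_connectedComponentIn hz fun w hw hw' =>
      hw'.elim (fun h' => hw.1 (Or.inl h')) fun h' => (hsub hw).1 (Or.inr h')
  have h2 : inn (P ∪ R) ⊆ inn (P ∪ Q) := by
    rw [hPQ.isSimpleClosed.inn_eq hz]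
    exact hPR.isSimpleClosed.isPreconnected_inn.subset_connectedComponentIn hz' fun w hw hw' =>
      hw'.elim (fun h' => hw.1 (Or.inl h')) fun h' => (hsub' hw).1 (Or.inl h')
  have h3 : P ∪ Q = P ∪ R := by
    rw [← hPQ.isSimpleClosed.frontier_inn ⟨z, hz⟩, ← hPR.isSimpleClosed.frontier_inn ⟨z, hz'⟩,
      h1.antisymm h2]
  obtain ⟨w, hwQ, hw⟩ := h.left.interior_nonempty
  rcases h3.subset (Or.inr hwQ) with h' | h'
  · exact hw (hPQ.inter ▸ ⟨h', hwQ⟩)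
  · exact hw (h.inter ▸ ⟨hwQ, h'⟩)

end IsLoop

/-- If two simple closed curves share `B`, then near a point of `B` a set that visits both sides
of the second visits the inside of the first. -/
lemma exists_mem_inn_of_both_sides {B K L D : Set Plane} (hBK : IsSimpleClosed (B ∪ K))
    (hBL : IsSimpleClosed (B ∪ L)) (hKB : K ∩ B ⊆ L) (hK : IsClosed K)
    (hL : IsClosed L) (hLc : IsPreconnected L) {w : Plane} (hwB : w ∈ B) (hwK : w ∉ K)
    (hwL : w ∉ L) (hne : (inn (B ∪ K)).Nonempty) (hdis : Disjoint (inn (B ∪ K)) (B ∪ L))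
    (hD : ∀ N ∈ nhds w, (∃ r ∈ N, r ∈ D ∧ r ∈ inn (B ∪ L)) ∧
      ∃ r ∈ N, r ∈ D ∧ r ∉ closure (inn (B ∪ L))) {N : Set Plane} (hN : N ∈ nhds w) :
    ∃ r ∈ N, r ∈ D ∧ r ∈ inn (B ∪ K) := by
  have hKL : IsClosed (K ∪ L) := hK.union hL
  have hwKL : (K ∪ L)ᶜ ∈ nhds w := hKL.isOpen_compl.mem_nhds fun h => h.elim hwK hwL
  obtain ⟨ε, hε, hball⟩ := Metric.mem_nhds_iff.1 (Filter.inter_mem hN hwKL)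
  obtain ⟨t, htb, ht⟩ := _root_.mem_closure_iff.1
    (hBK.subset_closure_inn hne (Or.inl hwB)) _ isOpen_ball (mem_ball_self hε)
  have htL : t ∉ B ∪ L := hdis.notMem_of_mem_left ht
  obtain ⟨⟨r₁, hr1, hr1D, hr1i⟩, r₂, hr2, hr2D, hr2i⟩ := hD _ (ball_mem_nhds w hε)
  obtain ⟨r, hr, hrD, hrL, hiff⟩ : ∃ r ∈ ball w ε, r ∈ D ∧ r ∉ B ∪ L ∧
      (t ∈ inn (B ∪ L) ↔ r ∈ inn (B ∪ L)) := by
    by_cases hti : t ∈ inn (B ∪ L)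
    · exact ⟨r₁, hr1, hr1D, hr1i.1, iff_of_true hti hr1i⟩
    · exact ⟨r₂, hr2, hr2D, fun h => hr2i (hBL.subset_closure_inn ⟨r₁, hr1i⟩ h),
        iff_of_false hti fun h => hr2i (subset_closure h)⟩
  refine ⟨r, (hball hr).1, hrD, ?_⟩
  have h1 : Sim (B ∪ L) t r := (hBL.sim_iff htL hrL).2 hiff
  have h2 : Sim (K ∪ L) t r := sim_of_isPreconnected hKL (convex_ball w ε).isPreconnected
    (disjoint_left.2 fun z hz => (hball hz).2) htb hr
  have hint : (B ∪ L) ∩ (K ∪ L) = L := by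
    rw [← inter_union_distrib_right, inter_comm, union_eq_right]
    exact hKB
  have h3 : Sim (B ∪ K) t r := Sim.union hBL.isClosed hKL (by rwa [hint]) h1 h2 (by
    rintro z (hz | hz)
    · exact Or.inl (Or.inl hz)
    · exact Or.inr (Or.inl hz))
  exact ((hBK.sim_iff ht.1 fun h => h.elim (fun h => hrL (Or.inl h))
    fun h => (hball hr).2 (Or.inl h)).1 h3).1 ht

lemma JordanCurve.exists_param (γ : JordanCurve) {s : Plane} (hs : s ∈ γ.img) :
    ∃ f : ℝ → Plane, Continuous f ∧ f 0 = s ∧ f 1 = s ∧ InjOn f (Ico 0 1) ∧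
      InjOn f (Ioc 0 1) ∧ f '' Icc 0 1 = γ.img := by
  obtain ⟨c, rfl⟩ := hs
  have hc : ‖toC c‖ = 1 := by
    rw [toC.norm_map]
    exact mem_sphere_zero_iff_norm.1 c.2
  have hc0 : toC c ≠ 0 := fun h => by simp [h] at hc
  let e : ℝ → ℂ := fun t => toC c * Complex.exp ((2 * Real.pi * t : ℝ) * Complex.I)
  have he : ∀ t, toC.symm (e t) ∈ unitCircle := fun t => by
    rw [unitCircle, mem_sphere_zero_iff_norm, toC.symm.norm_map, norm_mul, hc,
      Complex.norm_exp_ofReal_mul_I, one_mul]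
  let f : ℝ → Plane := fun t => γ.toFun ⟨toC.symm (e t), he t⟩
  have hfc : Continuous f := by
    refine γ.continuous.comp (Continuous.subtype_mk ?_ _)
    exact toC.symm.continuous.comp (by fun_prop)
  have hinj : ∀ s t, f s = f t → ∃ n : ℤ, s = t + n := by
    intro s t hst
    have h1 := toC.symm.injective (congrArg Subtype.val (γ.injective hst))
    obtain ⟨n, hn⟩ := Complex.exp_eq_exp_iff_exists_int.1 (mul_left_cancel₀ hc0 h1)
    refine ⟨n, ?_⟩
    have h2 : ((2 * Real.pi * s : ℝ) : ℂ) = ((2 * Real.pi * (t + n) : ℝ) : ℂ) := by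
      apply mul_right_cancel₀ Complex.I_ne_zero
      rw [hn]
      push_cast
      ring
    exact mul_left_cancel₀ Real.two_pi_pos.ne' (Complex.ofReal_injective h2)
  have hper : ∀ (t : ℝ) (n : ℤ), f (t + n) = f t := by
    intro t n
    have : e (t + n) = e t := by
      simp only [e]
      congr 1
      rw [Complex.exp_eq_exp_iff_exists_int]
      exact ⟨n, by push_cast; ring⟩
    simp only [f, this]
  have h0 : f 0 = γ.toFun c := by simp [f, e]
  refine ⟨f, hfc, h0, ?_, ?_, ?_, ?_⟩
  · rw [← h0, ← hper 0 1]
    simp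
  · intro s hs t ht hst
    obtain ⟨n, rfl⟩ := hinj s t hst
    have h1 : (n : ℝ) < 1 := by linarith [hs.2, ht.1]
    have h2 : (-1 : ℝ) < n := by linarith [hs.1, ht.2]
    have : n = 0 := by
      have h1' : n < 1 := by exact_mod_cast h1
      have h2' : -1 < n := by exact_mod_cast h2
      omega
    simp [this]
  · intro s hs t ht hst
    obtain ⟨n, rfl⟩ := hinj s t hst
    have h1 : (n : ℝ) < 1 := by linarith [hs.2, ht.1]
    have h2 : (-1 : ℝ) < n := by linarith [hs.1, ht.2]
    have : n = 0 := by
      have h1' : n < 1 := by exact_mod_cast h1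
      have h2' : -1 < n := by exact_mod_cast h2
      omega
    simp [this]
  · apply Subset.antisymm
    · rintro _ ⟨t, -, rfl⟩
      exact ⟨_, rfl⟩
    · rintro _ ⟨v, rfl⟩
      have hv : ‖toC v / toC c‖ = 1 := by
        rw [norm_div, hc, div_one, toC.norm_map]
        exact mem_sphere_zero_iff_norm.1 v.2
      set θ := Complex.arg (toC v / toC c)
      have hθ : Complex.exp (θ * Complex.I) = toC v / toC c := by
        have := Complex.norm_mul_exp_arg_mul_I (toC v / toC c)
        rwa [hv, Complex.ofReal_one, one_mul] at this
      refine ⟨Int.fract (θ / (2 * Real.pi)), ⟨Int.fract_nonneg _, (Int.fract_lt_one _).le⟩, ?_⟩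
      rw [← hper _ ⌊θ / (2 * Real.pi)⌋, Int.fract_add_floor]
      simp only [f]
      congr 1
      apply Subtype.ext
      apply toC.injective
      simp only [e, LinearIsometryEquiv.apply_symm_apply]
      rw [mul_div_cancel₀ _ Real.two_pi_pos.ne', hθ, mul_div_cancel₀ _ hc0]

lemma JordanCurve.exists_loop (γ : JordanCurve) {x y : Plane} (hx : x ∈ γ.img) (hy : y ∈ γ.img)
    (hxy : x ≠ y) : ∃ Q R, IsLoop Q R x y ∧ Q ∪ R = γ.img := by
  obtain ⟨f, hf, h0, h1, hi, hi', himg⟩ := γ.exists_param hx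
  rw [← himg] at hy
  obtain ⟨v, hv, rfl⟩ := hy
  have hv0 : 0 < v := hv.1.lt_of_ne fun h => hxy (by rw [← h, h0])
  have hv1 : v < 1 := hv.2.lt_of_ne fun h => hxy (by rw [h, h1])
  have hs1 : Icc 0 v ⊆ Ico 0 1 := fun t ht => ⟨ht.1, ht.2.trans_lt hv1⟩
  have hs2 : Icc v 1 ⊆ Ioc 0 1 := fun t ht => ⟨hv0.trans_le ht.1, ht.2⟩
  refine ⟨f '' Icc 0 v, f '' Icc v 1, ⟨⟨0, v, f, hv0, hf.continuousOn, hi.mono hs1, h0, rfl, rfl⟩,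
    IsArc.symm ⟨v, 1, f, hv1, hf.continuousOn, hi'.mono hs2, rfl, h1, rfl⟩, ?_⟩, ?_⟩
  · apply Subset.antisymm
    · rintro _ ⟨⟨s, hs, rfl⟩, t, ht, hst⟩
      rcases ht.2.eq_or_lt with rfl | ht1
      · left
        rw [← hst, h1]
      · have := hi ⟨hv0.le.trans ht.1, ht1⟩ (hs1 hs) hst
        right
        rw [le_antisymm hs.2 (this ▸ ht.1)]
        rfl
    · rintro z (rfl | rfl)
      · exact ⟨⟨0, left_mem_Icc.2 hv0.le, h0⟩, ⟨1, right_mem_Icc.2 hv1.le, h1⟩⟩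
      · exact ⟨⟨v, right_mem_Icc.2 hv0.le, rfl⟩, ⟨v, left_mem_Icc.2 hv1.le, rfl⟩⟩
  · rw [← image_union, Icc_union_Icc_eq_Icc hv0.le hv1.le, himg]

lemma JordanCurve.isSimpleClosed (γ : JordanCurve) : IsSimpleClosed γ.img := by
  obtain ⟨f, hf, h0, h1, hi, hi', himg⟩ := γ.exists_param (s := γ.toFun ⟨toC.symm 1, by
    simp [unitCircle]⟩) ⟨_, rfl⟩
  obtain ⟨Q, R, h, hQR⟩ := γ.exists_loop (x := f 0) (y := f (1 / 2))
    (himg ▸ ⟨0, by norm_num, rfl⟩) (himg ▸ ⟨1 / 2, by norm_num, rfl⟩)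
    fun h => by
      have := hi (by norm_num) (by norm_num) h
      norm_num at this
  rw [← hQR]
  exact h.isSimpleClosed

/-- `D` is an arc from `x` to `y` in the simple closed curve `S`. -/
def IsChord (S D : Set Plane) (x y : Plane) : Prop := ∃ L, IsLoop D L x y ∧ D ∪ L = S

namespace IsChord

variable {S D D₁ D₂ : Set Plane} {x y z : Plane}

lemma symm (h : IsChord S D x y) : IsChord S D y x := by
  obtain ⟨L, hL, rfl⟩ := h
  exact ⟨L, hL.swap, rfl⟩

lemma isArc (h : IsChord S D x y) : IsArc D x y := by
  obtain ⟨L, hL, rfl⟩ := h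
  exact hL.left

lemma subset (h : IsChord S D x y) : D ⊆ S := by
  obtain ⟨L, hL, rfl⟩ := h
  exact subset_union_left

lemma split_left (h : IsChord S D x y) (h1 : IsArc D₁ x z) (h2 : IsArc D₂ z y)
    (hu : D₁ ∪ D₂ = D) (hi : D₁ ∩ D₂ = {z}) : IsChord S D₁ x z := by
  obtain ⟨L, hL, rfl⟩ := h
  subst hu
  have hx2 : x ∉ D₂ := fun hx => h1.ne (hi.subset ⟨h1.left_mem, hx⟩)
  have hy1 : y ∉ D₁ := fun hy => h2.ne.symm (hi.subset ⟨hy, h2.right_mem⟩)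
  have hi2 : D₂ ∩ L = {y} := by
    apply Subset.antisymm
    · rintro w ⟨hw, hwL⟩
      rcases hL.inter.subset ⟨Or.inr hw, hwL⟩ with rfl | rfl
      · exact absurd hw hx2
      · rfl
    · rintro _ rfl
      exact ⟨h2.right_mem, hL.right.right_mem⟩
  refine ⟨D₂ ∪ L, ⟨h1, (h2.concat hL.right.symm hi2).symm, ?_⟩, (union_assoc _ _ _).symm⟩
  rw [inter_union_distrib_left, hi]
  apply Subset.antisymm
  · rintro w (rfl | ⟨hw, hwL⟩)
    · exact Or.inr rfl
    · rcases hL.inter.subset ⟨Or.inl hw, hwL⟩ with rfl | rfl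
      · exact Or.inl rfl
      · exact absurd hw hy1
  · rintro w (rfl | rfl)
    · exact Or.inr ⟨h1.left_mem, hL.right.left_mem⟩
    · exact Or.inl rfl

lemma split_right (h : IsChord S D x y) (h1 : IsArc D₁ x z) (h2 : IsArc D₂ z y)
    (hu : D₁ ∪ D₂ = D) (hi : D₁ ∩ D₂ = {z}) : IsChord S D₂ z y :=
  (h.symm.split_left h2.symm h1.symm (by rw [union_comm, hu]) (by rw [inter_comm, hi])).symm

end IsChord

lemma IsLoop.isChord {Q R : Set Plane} {x y : Plane} (h : IsLoop Q R x y) :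
    IsChord (Q ∪ R) Q x y :=
  ⟨R, h, rfl⟩

/-- The part of an arc between two of its interior points. -/
lemma IsArc.exists_subarc {Q : Set Plane} {p q x y : Plane} (h : IsArc Q p q)
    (hx : x ∈ Q \ {p, q}) (hy : y ∈ Q \ {p, q}) (hxy : x ≠ y) :
    ∃ M, IsArc M x y ∧ M ⊆ Q \ {p, q} ∧ ∀ S, IsChord S Q p q → IsChord S M x y := by
  have aux : ∀ {p q : Plane}, IsArc Q p q → x ∈ Q \ {p, q} → y ∈ Q \ {p, q} →
      ∀ Q₁ Q₂ : Set Plane, IsArc Q₁ p x → IsArc Q₂ x q → Q₁ ∪ Q₂ = Q → Q₁ ∩ Q₂ = {x} → y ∈ Q₂ →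
      ∃ M, IsArc M x y ∧ M ⊆ Q \ {p, q} ∧ ∀ S, IsChord S Q p q → IsChord S M x y := by
    intro p q h hx hy Q₁ Q₂ h1 h2 hu hi hy2
    obtain ⟨M, M', hM, hM', hMu, hMi⟩ := h2.split hy2 hxy.symm fun h => hy.2 (by simp [h])
    refine ⟨M, hM, ?_, fun S hS => (hS.split_right h1 h2 hu hi).split_left hM hM' hMu hMi⟩
    have hMQ : M ⊆ Q₂ := hMu ▸ subset_union_left
    refine fun w hw => ⟨hu ▸ Or.inr (hMQ hw), ?_⟩
    rintro (rfl | rfl)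
    · exact h1.ne (hi.subset ⟨h1.left_mem, hMQ hw⟩)
    · exact hM'.ne.symm (hMi.subset ⟨hw, hM'.right_mem⟩)
  obtain ⟨Q₁, Q₂, h1, h2, hu, hi⟩ := h.split hx.1 (fun h => hx.2 (by simp [h]))
    fun h => hx.2 (by simp [h])
  rcases hu.symm.subset hy.1 with hy1 | hy2
  · rw [pair_comm] at hx hy ⊢
    obtain ⟨M, hM, hMQ, hc⟩ := aux h.symm hx hy Q₂ Q₁ h2.symm h1.symm (by rw [union_comm, hu])
      (by rw [inter_comm, hi]) hy1
    exact ⟨M, hM, hMQ, fun S hS => hc S hS.symm⟩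
  · exact aux h hx hy Q₁ Q₂ h1 h2 hu hi hy2

/-- A Jordan curve that meets a simple closed curve at most twice, enters its inside, and leaves
its closed inside, crosses the inside in a single chord. -/
lemma JordanCurve.exists_excursion (δ : JordanCurve) {J : Set Plane} (hJ : IsSimpleClosed J)
    (h2 : (δ.img ∩ J).encard ≤ 2) {t o : Plane} (ht : t ∈ δ.img) (htJ : t ∈ inn J)
    (ho : o ∈ δ.img) (hoJ : o ∉ closure (inn J)) :
    ∃ x y D, x ∈ J ∧ y ∈ J ∧ IsChord δ.img D x y ∧ D \ {x, y} = δ.img ∩ inn J := by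
  have hto : t ≠ o := fun h => hoJ (subset_closure (h ▸ htJ))
  have hoi : o ∉ inn J := fun h => hoJ (subset_closure h)
  obtain ⟨Q, R, hQR, hδ⟩ := δ.exists_loop ht ho hto
  have key : ∀ Q : Set Plane, IsArc Q t o → ∃ z S₁ S₂, z ∈ J ∧ IsArc S₁ t z ∧ IsArc S₂ z o ∧
      S₁ ∪ S₂ = Q ∧ S₁ ∩ S₂ = {z} ∧ S₁ \ {z} ⊆ inn J ∧ t ∉ S₂ ∧ o ∉ S₁ := by
    intro Q hQ
    obtain ⟨z, S₁, hz, h1, hS1Q, hS1F, hor⟩ := hQ.exists_first_hit hJ.isOpen_inn.isClosed_compl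
      hoi (fun h => h htJ)
    have hin : S₁ \ {z} ⊆ inn J := fun w hw => by
      by_contra h
      exact hw.2 (hS1F.subset ⟨hw.1, h⟩)
    have hzc : z ∈ closure (inn J) := by
      refine closure_mono ?_ (h1.subset_closure_interior h1.right_mem)
      exact fun w hw => hin ⟨hw.1, fun h => hw.2 (Or.inr h)⟩
    obtain ⟨S₂, hS2, hu, hi⟩ := hor.resolve_left fun h => hoJ (h.1 ▸ hzc)
    refine ⟨z, S₁, S₂, (hJ.closure_inn_subset hzc).resolve_left hz, h1, hS2, hu, hi, hin,
      fun h => h1.ne (hi.subset ⟨h1.left_mem, h⟩), fun h => ?_⟩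
    exact hS2.ne.symm (hi.subset ⟨h, hS2.right_mem⟩)
  obtain ⟨x, A₁, A₂, hxJ, hA1, hA2, hAu, hAi, hAin, htA, hoA⟩ := key Q hQR.left
  obtain ⟨y, B₁, B₂, hyJ, hB1, hB2, hBu, hBi, hBin, htB, hoB⟩ := key R hQR.right
  have hinter : ∀ w, w ∈ A₁ ∪ A₂ → w ∈ B₁ ∪ B₂ → w = t ∨ w = o := fun w hw hw' =>
    hQR.inter.subset ⟨hAu ▸ hw, hBu ▸ hw'⟩
  have hxy : x ≠ y := by
    rintro rfl
    rcases hinter x (Or.inl hA1.right_mem) (Or.inl hB1.right_mem) with rfl | rfl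
    · exact htJ.1 hxJ
    · exact hoA hA1.right_mem
  have hDi : A₁ ∩ B₁ = {t} := by
    apply Subset.antisymm
    · rintro w ⟨hw, hw'⟩
      rcases hinter w (Or.inl hw) (Or.inl hw') with rfl | rfl
      · rfl
      · exact absurd hw hoA
    · rintro _ rfl
      exact ⟨hA1.left_mem, hB1.left_mem⟩
  have hLi : A₂ ∩ B₂ = {o} := by
    apply Subset.antisymm
    · rintro w ⟨hw, hw'⟩
      rcases hinter w (Or.inr hw) (Or.inr hw') with rfl | rfl
      · exact absurd hw htA
      · rfl
    · rintro _ rfl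
      exact ⟨hA2.right_mem, hB2.right_mem⟩
  have hloop : IsLoop (A₁ ∪ B₁) (A₂ ∪ B₂) x y := by
    refine ⟨hA1.symm.concat hB1 hDi, hA2.concat hB2.symm hLi, Subset.antisymm ?_ ?_⟩
    · rintro w ⟨hw | hw, hw' | hw'⟩
      · exact Or.inl (hAi.subset ⟨hw, hw'⟩)
      · rcases hinter w (Or.inl hw) (Or.inr hw') with rfl | rfl
        · exact absurd hw' htB
        · exact absurd hw hoA
      · rcases hinter w (Or.inr hw') (Or.inl hw) with rfl | rfl
        · exact absurd hw' htA
        · exact absurd hw hoB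
      · exact Or.inr (hBi.subset ⟨hw, hw'⟩)
    · rintro w (rfl | rfl)
      · exact ⟨Or.inl hA1.right_mem, Or.inl hA2.left_mem⟩
      · exact ⟨Or.inr hB1.right_mem, Or.inr hB2.left_mem⟩
  have hδ' : (A₁ ∪ B₁) ∪ (A₂ ∪ B₂) = δ.img := by
    rw [← hδ, ← hAu, ← hBu, union_union_union_comm]
  refine ⟨x, y, A₁ ∪ B₁, hxJ, hyJ, ⟨A₂ ∪ B₂, hloop, hδ'⟩, Subset.antisymm ?_ ?_⟩
  · rintro w ⟨hw, hwn⟩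
    refine ⟨hδ' ▸ Or.inl hw, ?_⟩
    rcases hw with hw | hw
    · exact hAin ⟨hw, fun h => hwn (Or.inl h)⟩
    · exact hBin ⟨hw, fun h => hwn (Or.inr h)⟩
  · rintro w ⟨hw, hwJ⟩
    have hwn : w ∉ ({x, y} : Set Plane) := by
      rintro (rfl | rfl)
      · exact hwJ.1 hxJ
      · exact hwJ.1 hyJ
    refine ⟨(hδ'.symm.subset hw).resolve_right fun hwL => hoi ?_, hwn⟩
    have hsub : (A₂ ∪ B₂) \ {x, y} ⊆ Jᶜ := by
      rintro v ⟨hv, hvn⟩ hvJ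
      have h3 : ({x, y, v} : Set Plane) ⊆ δ.img ∩ J := by
        rintro u (rfl | rfl | rfl)
        · exact ⟨hδ' ▸ Or.inl (Or.inl hA1.right_mem), hxJ⟩
        · exact ⟨hδ' ▸ Or.inl (Or.inr hB1.right_mem), hyJ⟩
        · exact ⟨hδ' ▸ Or.inr hv, hvJ⟩
      have h4 := (encard_le_encard h3).trans h2
      rw [encard_eq_three.2 ⟨x, y, v, hxy, fun h => hvn (by simp [h]), fun h => hvn (by simp [h]),
        rfl⟩] at h4
      exact absurd h4 (by norm_num)
    rw [hJ.inn_eq hwJ]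
    refine hloop.right.isPreconnected_interior.subset_connectedComponentIn ⟨hwL, hwn⟩ hsub
      ⟨Or.inl hA2.right_mem, ?_⟩
    rintro (rfl | rfl)
    · exact hoA hA1.right_mem
    · exact hoB hB1.right_mem

lemma exists_mem_inn_of_crossing {σ δ : JordanCurve} {D K : Set Plane} {a b w : Plane}
    (hD : IsChord σ.img D a b) (hJ : IsSimpleClosed (D ∪ K)) (hK : IsClosed K)
    (hKD : K ∩ D ⊆ {a, b}) (hw : w ∈ D \ {a, b}) (hδ : IsCrossing δ σ w)
    (hne : (inn (D ∪ K)).Nonempty) (hdis : Disjoint (inn (D ∪ K)) σ.img) :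
    (δ.img ∩ inn (D ∪ K)).Nonempty := by
  obtain ⟨L, hL, hDL⟩ := hD
  have hKL : K ∩ D ⊆ L := fun z hz => (hL.inter.symm.subset (hKD hz)).2
  obtain ⟨r, -, hr⟩ := exists_mem_inn_of_both_sides (D := δ.img) (w := w) hJ hL.isSimpleClosed
    hKL hK hL.right.isClosed hL.right.isPreconnected hw.1
    (fun h => hw.2 (hKD ⟨h, hw.1⟩)) (fun h => hw.2 (hL.inter.subset ⟨hw.1, h⟩)) hne
    (by rwa [hDL])
    (fun N hN => by
      rw [hDL]
      exact ⟨(hδ N hN).1, (hδ N hN).2.1⟩) Filter.univ_mem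
  exact ⟨r, hr⟩

/-- A family of Jordan curves in general position, all of which cross `γ`, and any two of which
meet at most once in the closed inside of `γ`. -/
structure IsPencil (Γ : Set JordanCurve) (γ : JordanCurve) : Prop where
  finite : Γ.Finite
  generalPosition : GeneralPosition Γ
  encard_le_two : ∀ a ∈ Γ, ∀ b ∈ Γ, a ≠ b → (a.img ∩ b.img).encard ≤ 2
  mem : γ ∈ Γ
  meets : ∀ a ∈ Γ, a ≠ γ → (a.img ∩ γ.img).Nonempty
  encard_le_one : ∀ a ∈ Γ \ {γ}, ∀ b ∈ Γ \ {γ}, a ≠ b →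
    (a.img ∩ b.img ∩ closure γ.inside).encard ≤ 1

namespace IsPencil

variable {Γ : Set JordanCurve} {γ α β δ : JordanCurve}

lemma no_three (h : IsPencil Γ γ) (hα : α ∈ Γ) (hβ : β ∈ Γ) (hδ : δ ∈ Γ) (hαβ : α ≠ β)
    (hβδ : β ≠ δ) (hαδ : α ≠ δ) {z : Plane} (h1 : z ∈ α.img) (h2 : z ∈ β.img) : z ∉ δ.img :=
  fun h3 => (h.generalPosition.2.2 α hα β hβ δ hδ z h1 h2 h3).elim hαβ fun h => h.elim hβδ hαδ

lemma crossing (h : IsPencil Γ γ) (hα : α ∈ Γ) (hβ : β ∈ Γ) (hαβ : α ≠ β) {z : Plane}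
    (h1 : z ∈ α.img) (h2 : z ∈ β.img) : IsCrossing α β z :=
  h.generalPosition.2.1 α hα β hβ hαβ z ⟨h1, h2⟩

lemma exists_outside (h : IsPencil Γ γ) (hα : α ∈ Γ) (hαγ : α ≠ γ) :
    ∃ o ∈ α.img, o ∉ closure γ.inside := by
  obtain ⟨w, hw1, hw2⟩ := h.meets α hα hαγ
  obtain ⟨o, -, ho⟩ := (h.crossing hα h.mem hαγ hw1 hw2 univ Filter.univ_mem).2.1
  exact ⟨o, ho⟩

lemma exists_inside (h : IsPencil Γ γ) (hα : α ∈ Γ) (hαγ : α ≠ γ) :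
    ∃ o ∈ α.img, o ∈ γ.inside := by
  obtain ⟨w, hw1, hw2⟩ := h.meets α hα hαγ
  obtain ⟨o, -, ho⟩ := (h.crossing hα h.mem hαγ hw1 hw2 univ Filter.univ_mem).1
  exact ⟨o, ho⟩

lemma eq_of_mem (h : IsPencil Γ γ) (hα : α ∈ Γ) (hβ : β ∈ Γ) (hαγ : α ≠ γ) (hβγ : β ≠ γ)
    (hαβ : α ≠ β) {z w : Plane} (hz : z ∈ closure γ.inside) (hw : w ∈ closure γ.inside)
    (hzα : z ∈ α.img) (hzβ : z ∈ β.img) (hwα : w ∈ α.img) (hwβ : w ∈ β.img) : z = w :=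
  encard_le_one_iff.1 (h.encard_le_one α ⟨hα, hαγ⟩ β ⟨hβ, hβγ⟩ hαβ) z w ⟨⟨hzα, hzβ⟩, hz⟩
    ⟨⟨hwα, hwβ⟩, hw⟩

end IsPencil

/-- A triangle in the inside of `γ` with sides `A`, `B`, `G` on `α`, `β`, `γ` whose inside
misses the three curves, whose side `A` is crossed by no curve of `Γ`, and whose side `G` is
crossed at most once by each curve. -/
structure IsTri (Γ : Set JordanCurve) (γ α β : JordanCurve) (p v q : Plane) (A B G : Set Plane) :
    Prop where
  memα : α ∈ Γ
  memβ : β ∈ Γ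
  neαγ : α ≠ γ
  neβγ : β ≠ γ
  neαβ : α ≠ β
  chordA : IsChord α.img A p v
  chordB : IsChord β.img B v q
  chordG : IsChord γ.img G q p
  interAB : A ∩ B = {v}
  interBG : B ∩ G = {q}
  interAG : A ∩ G = {p}
  nonempty : (inn (A ∪ B ∪ G)).Nonempty
  subset_inside : inn (A ∪ B ∪ G) ⊆ γ.inside
  disjointα : Disjoint (inn (A ∪ B ∪ G)) α.img
  disjointβ : Disjoint (inn (A ∪ B ∪ G)) β.img
  sideA : ∀ δ ∈ Γ, δ ≠ α → δ.img ∩ A ⊆ {p, v}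
  sideG : ∀ δ ∈ Γ, δ ≠ γ → (δ.img ∩ (G \ {p, q})).Subsingleton

namespace IsTri

variable {Γ : Set JordanCurve} {γ α β δ : JordanCurve} {p v q : Plane} {A B G : Set Plane}

lemma loop (h : IsTri Γ γ α β p v q A B G) : IsLoop (B ∪ G) A v p := by
  refine ⟨h.chordB.isArc.concat h.chordG.isArc h.interBG, h.chordA.isArc.symm, ?_⟩
  rw [union_inter_distrib_right, inter_comm B, h.interAB, inter_comm G, h.interAG]
  rfl

lemma eq_loop : B ∪ G ∪ A = A ∪ B ∪ G := by
  rw [union_assoc A, union_comm A]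

lemma isSimpleClosed (h : IsTri Γ γ α β p v q A B G) : IsSimpleClosed (A ∪ B ∪ G) := by
  rw [← eq_loop]
  exact h.loop.isSimpleClosed

lemma disjointγ (h : IsTri Γ γ α β p v q A B G) : Disjoint (inn (A ∪ B ∪ G)) γ.img :=
  disjoint_left.2 fun _ hz => (h.subset_inside hz).1

lemma subset_closure_inside (h : IsTri Γ γ α β p v q A B G) : A ∪ B ∪ G ⊆ closure γ.inside :=
  (h.isSimpleClosed.subset_closure_inn h.nonempty).trans (closure_mono h.subset_inside)

lemma mem_vertices (hΓ : IsPencil Γ γ) (h : IsTri Γ γ α β p v q A B G)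
    (hcell : ∀ δ ∈ Γ, δ.img ∩ inn (A ∪ B ∪ G) = ∅) {z : Plane} (hz : z ∈ A ∪ B ∪ G)
    (hzv : z ∈ arrVertices Γ) : z ∈ ({p, v, q} : Set Plane) := by
  have hother : ∀ σ : JordanCurve, ∃ δ ∈ Γ, δ ≠ σ ∧ z ∈ δ.img := by
    intro σ
    obtain ⟨δ, hδ, ε, hε, hne, hzδ, hzε⟩ := hzv
    by_cases hσ : δ = σ
    · exact ⟨ε, hε, fun h => hne (hσ.trans h.symm), hzε⟩
    · exact ⟨δ, hδ, hσ, hzδ⟩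
  by_contra hcon
  have hzp : z ≠ p := fun h => hcon (by simp [h])
  have hzv' : z ≠ v := fun h => hcon (by simp [h])
  have hzq : z ≠ q := fun h => hcon (by simp [h])
  have hJ := h.isSimpleClosed
  have hne := h.nonempty
  have hA := h.chordA.isArc.isClosed
  have hB := h.chordB.isArc.isClosed
  have hG := h.chordG.isArc.isClosed
  rcases hz with (hz | hz) | hz
  · obtain ⟨δ, hδ, hδα, hzδ⟩ := hother α
    rcases h.sideA δ hδ hδα ⟨hzδ, hz⟩ with h' | h'
    · exact hzp h'
    · exact hzv' h'
  · obtain ⟨δ, hδ, hδβ, hzδ⟩ := hother β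
    have heq : A ∪ B ∪ G = B ∪ (A ∪ G) := by rw [union_comm A B, union_assoc]
    have hdis := h.disjointβ
    have hc := hcell δ hδ
    rw [heq] at hJ hne hdis hc
    refine (exists_mem_inn_of_crossing h.chordB hJ (hA.union hG) ?_ ⟨hz, ?_⟩
      (hΓ.crossing hδ h.memβ hδβ hzδ (h.chordB.subset hz)) hne hdis).ne_empty hc
    · rw [union_inter_distrib_right, h.interAB, inter_comm, h.interBG]
      rfl
    · rintro (h' | h')
      exacts [hzv' h', hzq h']
  · obtain ⟨δ, hδ, hδγ, hzδ⟩ := hother γ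
    have hdis := h.disjointγ
    have hc := hcell δ hδ
    rw [union_comm _ G] at hJ hne hdis hc
    refine (exists_mem_inn_of_crossing h.chordG hJ (hA.union hB) ?_ ⟨hz, ?_⟩
      (hΓ.crossing hδ hΓ.mem hδγ hzδ (h.chordG.subset hz)) hne hdis).ne_empty hc
    · rw [union_inter_distrib_right, h.interAG, h.interBG, union_comm]
      rfl
    · rintro (h' | h')
      exacts [hzq h', hzp h']

lemma isTriangleCellOn (hΓ : IsPencil Γ γ) (h : IsTri Γ γ α β p v q A B G)
    (hcell : ∀ δ ∈ Γ, δ.img ∩ inn (A ∪ B ∪ G) = ∅) :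
    IsTriangleCellOn Γ γ (inn (A ∪ B ∪ G)) := by
  have hJ := h.isSimpleClosed
  have hfr := hJ.frontier_inn h.nonempty
  have hpα := h.chordA.subset h.chordA.isArc.left_mem
  have hvα := h.chordA.subset h.chordA.isArc.right_mem
  have hvβ := h.chordB.subset h.chordB.isArc.left_mem
  have hqβ := h.chordB.subset h.chordB.isArc.right_mem
  have hqγ := h.chordG.subset h.chordG.isArc.left_mem
  have hpγ := h.chordG.subset h.chordG.isArc.right_mem
  have hpJ : p ∈ A ∪ B ∪ G := Or.inr h.chordG.isArc.right_mem
  have hqJ : q ∈ A ∪ B ∪ G := Or.inr h.chordG.isArc.left_mem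
  have hvJ : v ∈ A ∪ B ∪ G := Or.inl (Or.inl h.chordA.isArc.right_mem)
  have hverts : (A ∪ B ∪ G) ∩ arrVertices Γ = {p, v, q} := by
    apply Subset.antisymm
    · exact fun z hz => h.mem_vertices hΓ hcell hz.1 hz.2
    · rintro z (rfl | rfl | rfl)
      · exact ⟨hpJ, α, h.memα, γ, hΓ.mem, h.neαγ, hpα, hpγ⟩
      · exact ⟨hvJ, α, h.memα, β, h.memβ, h.neαβ, hvα, hvβ⟩
      · exact ⟨hqJ, β, h.memβ, γ, hΓ.mem, h.neβγ, hqβ, hqγ⟩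
  have hsub : A ∪ B ∪ G ⊆ γ.img ∪ α.img ∪ β.img := by
    rintro z ((hz | hz) | hz)
    · exact Or.inl (Or.inr (h.chordA.subset hz))
    · exact Or.inr (h.chordB.subset hz)
    · exact Or.inl (Or.inl (h.chordG.subset hz))
  have hcu : A ∪ B ∪ G ⊆ curvesUnion Γ := fun z hz => by
    simp only [curvesUnion, mem_iUnion]
    rcases hsub hz with (hz | hz) | hz
    exacts [⟨γ, hΓ.mem, hz⟩, ⟨α, h.memα, hz⟩, ⟨β, h.memβ, hz⟩]
  refine ⟨?_, hJ.isBounded_inn, ?_, ?_, α, h.memα, β, h.memβ, h.neαγ, h.neβγ, h.neαβ, ?_, ?_, ?_,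
    ?_⟩
  · obtain ⟨t, ht⟩ := h.nonempty
    have hTc : inn (A ∪ B ∪ G) ⊆ (curvesUnion Γ)ᶜ := by
      intro z hz hzc
      simp only [curvesUnion, mem_iUnion] at hzc
      obtain ⟨δ, hδ, hzδ⟩ := hzc
      exact (hcell δ hδ).subset ⟨hzδ, hz⟩
    refine ⟨t, hTc ht, Subset.antisymm
      (hJ.isPreconnected_inn.subset_connectedComponentIn ht hTc) ?_⟩
    rw [hJ.inn_eq ht]
    exact connectedComponentIn_mono _ (compl_subset_compl.2 hcu)
  · rw [hfr, hverts]
    exact encard_eq_three.2 ⟨p, v, q, h.chordA.isArc.ne, h.chordG.isArc.ne.symm,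
      h.chordB.isArc.ne, rfl⟩
  · exact ⟨p, hfr.symm.subset hpJ, hpγ⟩
  · rw [hfr]
    exact hsub
  · exact ⟨p, hfr.symm.subset hpJ, hpα⟩
  · exact ⟨q, hfr.symm.subset hqJ, hqβ⟩
  · rintro δ hδ ⟨z, hz, hzδ⟩
    rw [hfr] at hz
    by_contra! hcon
    obtain ⟨hδγ, hδα, hδβ⟩ := hcon
    have hzv : z ∈ arrVertices Γ := by
      rcases hsub hz with (hz | hz) | hz
      exacts [⟨δ, hδ, γ, hΓ.mem, hδγ, hzδ, hz⟩, ⟨δ, hδ, α, h.memα, hδα, hzδ, hz⟩,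
        ⟨δ, hδ, β, h.memβ, hδβ, hzδ, hz⟩]
    rcases h.mem_vertices hΓ hcell hz hzv with rfl | rfl | rfl
    · exact hΓ.no_three h.memα hΓ.mem hδ h.neαγ hδγ.symm hδα.symm hpα hpγ hzδ
    · exact hΓ.no_three h.memα h.memβ hδ h.neαβ hδβ.symm hδα.symm hvα hvβ hzδ
    · exact hΓ.no_three h.memβ hΓ.mem hδ h.neβγ hδγ.symm hδβ.symm hqβ hqγ hzδ

lemma exists_excursion (hΓ : IsPencil Γ γ) (h : IsTri Γ γ α β p v q A B G) (hδ : δ ∈ Γ)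
    (hmeet : (δ.img ∩ inn (A ∪ B ∪ G)).Nonempty) :
    δ ≠ α ∧ δ ≠ β ∧ δ ≠ γ ∧ ∃ x y D, x ∈ G \ {q, p} ∧ y ∈ B \ {v, q} ∧ IsChord δ.img D x y ∧
      D \ {x, y} = δ.img ∩ inn (A ∪ B ∪ G) := by
  obtain ⟨t, htδ, htT⟩ := hmeet
  have hδα : δ ≠ α := by
    rintro rfl
    exact h.disjointα.notMem_of_mem_left htT htδ
  have hδβ : δ ≠ β := by
    rintro rfl
    exact h.disjointβ.notMem_of_mem_left htT htδ
  have hδγ : δ ≠ γ := by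
    rintro rfl
    exact h.disjointγ.notMem_of_mem_left htT htδ
  have hp : p ∉ δ.img := hΓ.no_three h.memα hΓ.mem hδ h.neαγ hδγ.symm hδα.symm
    (h.chordA.subset h.chordA.isArc.left_mem) (h.chordG.subset h.chordG.isArc.right_mem)
  have hv : v ∉ δ.img := hΓ.no_three h.memα h.memβ hδ h.neαβ hδβ.symm hδα.symm
    (h.chordA.subset h.chordA.isArc.right_mem) (h.chordB.subset h.chordB.isArc.left_mem)
  have hq : q ∉ δ.img := hΓ.no_three h.memβ hΓ.mem hδ h.neβγ hδγ.symm hδβ.symm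
    (h.chordB.subset h.chordB.isArc.right_mem) (h.chordG.subset h.chordG.isArc.left_mem)
  have hA : ∀ z ∈ δ.img, z ∉ A := by
    intro z hz hzA
    rcases h.sideA δ hδ hδα ⟨hz, hzA⟩ with rfl | rfl
    exacts [hp hz, hv hz]
  have hBs : (δ.img ∩ B).Subsingleton := fun z hz w hw =>
    hΓ.eq_of_mem hδ h.memβ hδγ h.neβγ hδβ (h.subset_closure_inside (Or.inl (Or.inr hz.2)))
      (h.subset_closure_inside (Or.inl (Or.inr hw.2))) hz.1 (h.chordB.subset hz.2) hw.1
      (h.chordB.subset hw.2)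
  have hGn : ∀ z ∈ δ.img ∩ G, z ∈ G \ {p, q} := by
    refine fun z hz => ⟨hz.2, ?_⟩
    rintro (rfl | rfl)
    exacts [hp hz.1, hq hz.1]
  have hGs : (δ.img ∩ G).Subsingleton := fun z hz w hw =>
    h.sideG δ hδ hδγ ⟨hz.1, hGn z hz⟩ ⟨hw.1, hGn w hw⟩
  refine ⟨hδα, hδβ, hδγ, ?_⟩
  have hcard : (δ.img ∩ (A ∪ B ∪ G)).encard ≤ 2 := by
    have hsub : δ.img ∩ (A ∪ B ∪ G) ⊆ (δ.img ∩ B) ∪ (δ.img ∩ G) := by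
      rintro z ⟨hz, (hzA | hzB) | hzG⟩
      exacts [absurd hzA (hA z hz), Or.inl ⟨hz, hzB⟩, Or.inr ⟨hz, hzG⟩]
    refine (encard_le_encard hsub).trans ((encard_union_le _ _).trans ?_)
    refine (add_le_add (encard_le_one_iff_subsingleton.2 hBs)
      (encard_le_one_iff_subsingleton.2 hGs)).trans ?_
    norm_num
  obtain ⟨o, hoδ, ho⟩ := hΓ.exists_outside hδ hδγ
  obtain ⟨x, y, D, hx, hy, hD, hDT⟩ := δ.exists_excursion h.isSimpleClosed hcard htδ htT hoδ
    fun h' => ho (closure_mono h.subset_inside h')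
  have hxδ := hD.subset hD.isArc.left_mem
  have hyδ := hD.subset hD.isArc.right_mem
  have hxy := hD.isArc.ne
  have hBn : ∀ z ∈ δ.img ∩ B, z ∈ B \ {v, q} := by
    refine fun z hz => ⟨hz.2, ?_⟩
    rintro (rfl | rfl)
    exacts [hv hz.1, hq hz.1]
  rw [pair_comm] at hGn
  rcases hx with (hx | hx) | hx
  · exact absurd hx (hA x hxδ)
  · rcases hy with (hy | hy) | hy
    · exact absurd hy (hA y hyδ)
    · exact absurd (hBs ⟨hxδ, hx⟩ ⟨hyδ, hy⟩) hxy
    · exact ⟨y, x, D, hGn y ⟨hyδ, hy⟩, hBn x ⟨hxδ, hx⟩, hD.symm, by rwa [pair_comm]⟩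
  · rcases hy with (hy | hy) | hy
    · exact absurd hy (hA y hyδ)
    · exact ⟨x, y, D, hGn x ⟨hxδ, hx⟩, hBn y ⟨hyδ, hy⟩, hD, hDT⟩
    · exact absurd (hGs ⟨hxδ, hx⟩ ⟨hyδ, hy⟩) hxy

end IsTri

/-- A half-open arc that avoids a simple closed curve and ends outside stays outside. -/
lemma IsArc.disjoint_inn {S J : Set Plane} {z y : Plane} (hS : IsArc S z y)
    (hJ : IsSimpleClosed J) (hSJ : Disjoint (S \ {z}) J) (hy : y ∉ inn J) :
    Disjoint (S \ {z}) (inn J) := by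
  rw [disjoint_left]
  intro w hw hwi
  refine hy ?_
  rw [hJ.inn_eq hwi]
  exact hS.isPreconnected_diff_left.subset_connectedComponentIn hw
    (fun u hu => hSJ.notMem_of_mem_left hu) ⟨hS.right_mem, hS.ne.symm⟩

namespace IsTri

variable {Γ : Set JordanCurve} {γ α β δ ε : JordanCurve} {p v q : Plane} {A B G : Set Plane}

/-- Cutting off the corner `q` by a curve that no other curve crosses between `G` and `B`. -/
lemma cut_corner (h : IsTri Γ γ α β p v q A B G) (hδ : δ ∈ Γ) (hδβ : δ ≠ β) (hδγ : δ ≠ γ)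
    {x y : Plane} {D : Set Plane} (hx : x ∈ G \ {q, p}) (hy : y ∈ B \ {v, q})
    (hD : IsChord δ.img D x y) (hDT : D \ {x, y} = δ.img ∩ inn (A ∪ B ∪ G))
    (hside : ∀ ε ∈ Γ, ε ≠ δ → ε.img ∩ D ⊆ {x, y}) :
    ∃ (B' G' : Set Plane), IsTri Γ γ δ β x y q D B' G' ∧
      inn (D ∪ B' ∪ G') ⊆ inn (A ∪ B ∪ G) ∧ Disjoint (inn (D ∪ B' ∪ G')) δ.img := by
  have hB := h.chordB.isArc
  have hG := h.chordG.isArc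
  obtain ⟨B₁, B₂, hB1, hB2, hBu, hBi⟩ := hB.split hy.1 (fun h' => hy.2 (by simp [h']))
    fun h' => hy.2 (by simp [h'])
  obtain ⟨G₁, G₂, hG1, hG2, hGu, hGi⟩ := hG.split hx.1 (fun h' => hx.2 (by simp [h']))
    fun h' => hx.2 (by simp [h'])
  have hB2B : B₂ ⊆ B := hBu ▸ subset_union_right
  have hB1B : B₁ ⊆ B := hBu ▸ subset_union_left
  have hG1G : G₁ ⊆ G := hGu ▸ subset_union_left
  have hG2G : G₂ ⊆ G := hGu ▸ subset_union_right
  have hxB : x ∉ B := fun h' => hx.2 (Or.inl (h.interBG.subset ⟨h', hx.1⟩))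
  have hyG : y ∉ G := fun h' => hy.2 (Or.inr (h.interBG.subset ⟨hy.1, h'⟩))
  have hqB1 : q ∉ B₁ := fun h' => hB2.ne.symm (hBi.subset ⟨h', hB2.right_mem⟩)
  have hpG1 : p ∉ G₁ := fun h' => hG2.ne.symm (hGi.subset ⟨h', hG2.right_mem⟩)
  have hBG : B₂ ∩ G₁ = {q} := Subset.antisymm
    ((inter_subset_inter hB2B hG1G).trans h.interBG.subset)
    (singleton_subset_iff.2 ⟨hB2.right_mem, hG1.left_mem⟩)
  have hchord : IsChord (A ∪ B ∪ G) (B₂ ∪ G₁) y x := by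
    rw [← eq_loop]
    have hB2G : B₂ ∩ G = {q} := Subset.antisymm
      ((inter_subset_inter_left _ hB2B).trans h.interBG.subset)
      (singleton_subset_iff.2 ⟨hB2.right_mem, hG.left_mem⟩)
    refine (h.loop.isChord.split_right hB1 (hB2.concat hG hB2G)
      (by rw [← union_assoc, hBu]) ?_).split_left (hB2.concat hG1 hBG) hG2
      (by rw [union_assoc, hGu]) ?_
    · rw [inter_union_distrib_left, hBi, union_eq_left]
      rintro z ⟨hz, hzG⟩
      rw [h.interBG.subset ⟨hB1B hz, hzG⟩] at hz
      exact absurd hz hqB1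
    · rw [union_inter_distrib_right, hGi, union_eq_right]
      rintro z ⟨hz, hzG⟩
      have hzq : z = q := h.interBG.subset ⟨hB2B hz, hG2G hzG⟩
      subst hzq
      exact hGi.subset ⟨hG1.left_mem, hzG⟩
  obtain ⟨R, hloop, hJ⟩ := hchord
  have hPi : D \ {y, x} ⊆ inn (B₂ ∪ G₁ ∪ R) := by
    rw [hJ, pair_comm, hDT]
    exact inter_subset_right
  have hsub := hloop.crosscut_subset hD.isArc.symm hPi
  have hne := hloop.crosscut_nonempty hD.isArc.symm hPi
  rw [hJ] at hsub
  rw [← union_assoc] at hsub hne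
  have hDmem : ∀ z ∈ D, z = x ∨ z = y ∨ z ∈ inn (A ∪ B ∪ G) := fun z hz => by
    by_cases hzx : z ∈ ({x, y} : Set Plane)
    · exact hzx.imp_right Or.inl
    · exact Or.inr (Or.inr (hDT.subset ⟨hz, hzx⟩).2)
  have hdisδ : Disjoint (inn (D ∪ B₂ ∪ G₁)) δ.img := disjoint_left.2 fun z hz hzδ =>
    hz.1 (Or.inl (Or.inl (hDT.symm.subset ⟨hzδ, hsub hz⟩).1))
  refine ⟨B₂, G₁, ?_, hsub, hdisδ⟩
  exact
    { memα := hδ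
      memβ := h.memβ
      neαγ := hδγ
      neβγ := h.neβγ
      neαβ := hδβ
      chordA := hD
      chordB := h.chordB.split_right hB1 hB2 hBu hBi
      chordG := h.chordG.split_left hG1 hG2 hGu hGi
      interAB := by
        refine Subset.antisymm ?_ (singleton_subset_iff.2 ⟨hD.isArc.right_mem, hB2.left_mem⟩)
        rintro z ⟨hz, hzB⟩
        rcases hDmem z hz with rfl | rfl | hzi
        · exact absurd (hB2B hzB) hxB
        · rfl
        · exact absurd (Or.inl (Or.inr (hB2B hzB))) hzi.1
      interBG := hBG
      interAG := by
        refine Subset.antisymm ?_ (singleton_subset_iff.2 ⟨hD.isArc.left_mem, hG1.right_mem⟩)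
        rintro z ⟨hz, hzG⟩
        rcases hDmem z hz with rfl | rfl | hzi
        · rfl
        · exact absurd (hG1G hzG) hyG
        · exact absurd (Or.inr (hG1G hzG)) hzi.1
      nonempty := hne
      subset_inside := hsub.trans h.subset_inside
      disjointα := hdisδ
      disjointβ := h.disjointβ.mono_left hsub
      sideA := hside
      sideG := fun ε hε hεγ => (h.sideG ε hε hεγ).anti <| by
        rintro z ⟨hzε, hzG, hzn⟩
        refine ⟨hzε, hG1G hzG, ?_⟩
        rintro (rfl | rfl)
        · exact hpG1 hzG
        · exact hzn (Or.inr rfl) }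

/-- The triangle with base on `G` formed by two curves that cross inside a triangle. -/
lemma cut_base (hΓ : IsPencil Γ γ) (h : IsTri Γ γ α β p v q A B G) (hδ : δ ∈ Γ) (hε : ε ∈ Γ)
    (hεδ : ε ≠ δ) (hδγ : δ ≠ γ) (hεγ : ε ≠ γ) {x y x' y' z : Plane} {D D₁ D₂ E : Set Plane}
    (hx : x ∈ G \ {q, p}) (hy : y ∈ B \ {v, q}) (hD : IsChord δ.img D x y)
    (hDT : D \ {x, y} = δ.img ∩ inn (A ∪ B ∪ G)) (hx' : x' ∈ G \ {q, p}) (hy' : y' ∈ B \ {v, q})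
    (hE : IsChord ε.img E x' y') (hET : E \ {x', y'} = ε.img ∩ inn (A ∪ B ∪ G))
    (hD1 : IsArc D₁ x z) (hD2 : IsArc D₂ z y) (hDu : D₁ ∪ D₂ = D) (hDi : D₁ ∩ D₂ = {z})
    (hzε : z ∈ ε.img) (hside : ∀ c ∈ Γ, c ≠ δ → c.img ∩ D₁ ⊆ {x, z}) :
    ∃ (B' G' : Set Plane), IsTri Γ γ δ ε x z x' D₁ B' G' ∧
      inn (D₁ ∪ B' ∪ G') ⊆ inn (A ∪ B ∪ G) ∧ Disjoint (inn (D₁ ∪ B' ∪ G')) δ.img := by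
  have hJ := h.isSimpleClosed
  have hDmem : ∀ z ∈ D, z = x ∨ z = y ∨ z ∈ inn (A ∪ B ∪ G) := fun z hz => by
    by_cases hzx : z ∈ ({x, y} : Set Plane)
    · exact hzx.imp_right Or.inl
    · exact Or.inr (Or.inr (hDT.subset ⟨hz, hzx⟩).2)
  have hEmem : ∀ z ∈ E, z = x' ∨ z = y' ∨ z ∈ inn (A ∪ B ∪ G) := fun z hz => by
    by_cases hzx : z ∈ ({x', y'} : Set Plane)
    · exact hzx.imp_right Or.inl
    · exact Or.inr (Or.inr (hET.subset ⟨hz, hzx⟩).2)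
  have hD1D : D₁ ⊆ D := hDu ▸ subset_union_left
  have hD2D : D₂ ⊆ D := hDu ▸ subset_union_right
  have hzx : z ≠ x := hD1.ne.symm
  have hzy : z ≠ y := hD2.ne
  have hzT : z ∈ inn (A ∪ B ∪ G) :=
    ((hDmem z (hD1D hD1.right_mem)).resolve_left hzx).resolve_left hzy
  have hzE : z ∈ E := (hET.symm.subset ⟨hzε, hzT⟩).1
  have hGJ : ∀ w ∈ G, w ∉ inn (A ∪ B ∪ G) := fun w hw hwi => hwi.1 (Or.inr hw)
  have hBJ : ∀ w ∈ B, w ∉ inn (A ∪ B ∪ G) := fun w hw hwi => hwi.1 (Or.inl (Or.inr hw))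
  obtain ⟨E₁, E₂, hE1, hE2, hEu, hEi⟩ := hE.isArc.split hzE (fun h' => hGJ x' hx'.1 (h' ▸ hzT))
    fun h' => hBJ y' hy'.1 (h' ▸ hzT)
  have hE1E : E₁ ⊆ E := hEu ▸ subset_union_left
  have hE2E : E₂ ⊆ E := hEu ▸ subset_union_right
  have hxγ := h.chordG.subset hx.1
  have hxδ := hD.subset hD.isArc.left_mem
  have hxε : x ∉ ε.img := hΓ.no_three hΓ.mem hδ hε hδγ.symm hεδ.symm hεγ.symm hxγ hxδ
  have hxx : x' ≠ x := fun h' => hxε (h' ▸ hE.subset hE.isArc.left_mem)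
  have hcl : closure (inn (A ∪ B ∪ G)) ⊆ closure γ.inside := closure_mono h.subset_inside
  have hDcl : ∀ w ∈ D, w ∈ closure γ.inside := by
    intro w hw
    rcases hDmem w hw with rfl | rfl | hwi
    · exact h.subset_closure_inside (Or.inr hx.1)
    · exact h.subset_closure_inside (Or.inl (Or.inr hy.1))
    · exact hcl (subset_closure hwi)
  have hDE : ∀ w ∈ D, w ∈ E → w = z := fun w hw hwE =>
    hΓ.eq_of_mem hδ hε hδγ hεγ hεδ.symm (hDcl w hw) (hDcl z (hD1D hD1.right_mem))
      (hD.subset hw) (hE.subset hwE) (hD.subset (hD1D hD1.right_mem)) hzε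
  have hDE1 : D₁ ∩ E₁ = {z} := Subset.antisymm
    (fun w hw => hDE w (hD1D hw.1) (hE1E hw.2))
    (singleton_subset_iff.2 ⟨hD1.right_mem, hE1.right_mem⟩)
  have hyD1 : y ∉ D₁ := fun h' => hD2.ne.symm (hDi.subset ⟨h', hD2.right_mem⟩)
  have hyE1 : y' ∉ E₁ := fun h' => hE2.ne.symm (hEi.subset ⟨h', hE2.right_mem⟩)
  have hxD2 : x ∉ D₂ := fun h' => hD1.ne (hDi.subset ⟨hD1.left_mem, h'⟩)
  have hxE2 : x' ∉ E₂ := fun h' => hE1.ne (hEi.subset ⟨hE1.left_mem, h'⟩)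
  have hyG : y ∉ G := fun h' => hy.2 (Or.inr (h.interBG.subset ⟨hy.1, h'⟩))
  have hyG' : y' ∉ G := fun h' => hy'.2 (Or.inr (h.interBG.subset ⟨hy'.1, h'⟩))
  obtain ⟨M, hM, hMG, hMc⟩ := h.chordG.isArc.exists_subarc hx' hx hxx
  have hMG' : M ⊆ G := hMG.trans sdiff_subset
  have hGchord : IsChord (A ∪ B ∪ G) G q p := by
    have hu : A ∪ B ∪ G = B ∪ G ∪ A := eq_loop.symm
    rw [hu]
    exact h.loop.isChord.split_right h.chordB.isArc h.chordG.isArc rfl h.interBG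
  obtain ⟨R, hloop, hMR⟩ := hMc _ hGchord
  have hP : IsArc (E₁ ∪ D₁) x' x := hE1.concat hD1.symm (by rw [inter_comm, hDE1])
  have hPi : (E₁ ∪ D₁) \ {x', x} ⊆ inn (M ∪ R) := by
    rw [hMR]
    rintro w ⟨hw | hw, hwn⟩
    · rcases hEmem w (hE1E hw) with rfl | rfl | hwi
      exacts [absurd (Or.inl rfl) hwn, absurd hw hyE1, hwi]
    · rcases hDmem w (hD1D hw) with rfl | rfl | hwi
      exacts [absurd (Or.inr rfl) hwn, absurd hw hyD1, hwi]
  have hJ' := (hloop.crosscut hP hPi).isSimpleClosed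
  have hsub := hloop.crosscut_subset hP hPi
  have hne := hloop.crosscut_nonempty hP hPi
  rw [hMR] at hsub
  rw [union_comm E₁ D₁] at hsub hne hJ'
  have htail : ∀ w ∈ D₂, w ∈ D₁ ∪ E₁ ∪ M → w = z := by
    rintro w hw ((hw' | hw') | hw')
    · exact hDi.subset ⟨hw', hw⟩
    · exact hDE w (hD2D hw) (hE1E hw')
    · rcases hDmem w (hD2D hw) with rfl | rfl | hwi
      exacts [absurd hw hxD2, absurd (hMG' hw') hyG, absurd hwi (hGJ w (hMG' hw'))]
  have htail' : ∀ w ∈ E₂, w ∈ D₁ ∪ E₁ ∪ M → w = z := by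
    rintro w hw ((hw' | hw') | hw')
    · exact hDE w (hD1D hw') (hE2E hw)
    · exact hEi.subset ⟨hw', hw⟩
    · rcases hEmem w (hE2E hw) with rfl | rfl | hwi
      exacts [absurd hw hxE2, absurd (hMG' hw') hyG', absurd hwi (hGJ w (hMG' hw'))]
  have hzJ' : z ∉ inn (D₁ ∪ E₁ ∪ M) := fun h' => h'.1 (Or.inl (Or.inl hD1.right_mem))
  have hdisD : Disjoint (inn (D₁ ∪ E₁ ∪ M)) δ.img := by
    rw [disjoint_left]
    intro w hw hwδ
    rcases hDu.symm.subset (hDT.symm.subset ⟨hwδ, hsub hw⟩).1 with hw' | hw'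
    · exact hw.1 (Or.inl (Or.inl hw'))
    · refine (hD2.disjoint_inn hJ' (disjoint_left.2 fun u hu hu' => hu.2 (htail u hu.1 hu'))
        fun hyi => hBJ y hy.1 (hsub hyi)).notMem_of_mem_left ⟨hw', ?_⟩ hw
      rintro rfl
      exact hzJ' hw
  have hdisE : Disjoint (inn (D₁ ∪ E₁ ∪ M)) ε.img := by
    rw [disjoint_left]
    intro w hw hwε
    rcases hEu.symm.subset (hET.symm.subset ⟨hwε, hsub hw⟩).1 with hw' | hw'
    · exact hw.1 (Or.inl (Or.inr hw'))
    · refine (hE2.disjoint_inn hJ' (disjoint_left.2 fun u hu hu' => hu.2 (htail' u hu.1 hu'))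
        fun hyi => hBJ y' hy'.1 (hsub hyi)).notMem_of_mem_left ⟨hw', ?_⟩ hw
      rintro rfl
      exact hzJ' hw
  refine ⟨E₁, M, ?_, hsub, hdisD⟩
  exact
    { memα := hδ
      memβ := hε
      neαγ := hδγ
      neβγ := hεγ
      neαβ := hεδ.symm
      chordA := hD.split_left hD1 hD2 hDu hDi
      chordB := (hE.split_left hE1 hE2 hEu hEi).symm
      chordG := hMc _ h.chordG
      interAB := hDE1
      interBG := by
        refine Subset.antisymm ?_ (singleton_subset_iff.2 ⟨hE1.left_mem, hM.left_mem⟩)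
        rintro w ⟨hw, hw'⟩
        rcases hEmem w (hE1E hw) with rfl | rfl | hwi
        exacts [rfl, absurd hw hyE1, absurd hwi (hGJ w (hMG' hw'))]
      interAG := by
        refine Subset.antisymm ?_ (singleton_subset_iff.2 ⟨hD1.left_mem, hM.right_mem⟩)
        rintro w ⟨hw, hw'⟩
        rcases hDmem w (hD1D hw) with rfl | rfl | hwi
        exacts [rfl, absurd hw hyD1, absurd hwi (hGJ w (hMG' hw'))]
      nonempty := hne
      subset_inside := hsub.trans h.subset_inside
      disjointα := hdisD
      disjointβ := hdisE
      sideA := hside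
      sideG := fun c hc hcγ => (h.sideG c hc hcγ).anti <| by
        rintro w ⟨hwc, hwM, -⟩
        rw [pair_comm]
        exact ⟨hwc, hMG hwM⟩ }

lemma exists_smaller (hΓ : IsPencil Γ γ) (h : IsTri Γ γ α β p v q A B G) (hδ : δ ∈ Γ)
    (hmeet : (δ.img ∩ inn (A ∪ B ∪ G)).Nonempty) :
    ∃ α' β' p' v' q' A' B' G', IsTri Γ γ α' β' p' v' q' A' B' G' ∧
      inn (A' ∪ B' ∪ G') ⊆ inn (A ∪ B ∪ G) ∧ Disjoint (inn (A' ∪ B' ∪ G')) δ.img := by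
  obtain ⟨hδα, hδβ, hδγ, x, y, D, hx, hy, hD, hDT⟩ := h.exists_excursion hΓ hδ hmeet
  set F := (⋃ ε ∈ Γ \ {δ}, δ.img ∩ ε.img) \ {x} with hF
  have hFfin : F.Finite := ((hΓ.finite.subset sdiff_subset).biUnion fun ε hε =>
    hΓ.generalPosition.1 δ hδ ε hε.1 fun h' => hε.2 h'.symm).subset sdiff_subset
  have hFmem : ∀ ε ∈ Γ, ε ≠ δ → ∀ w ∈ D, w ∈ ε.img → w ≠ x → w ∈ F := fun ε hε hεδ w hw hwε hwx =>
    ⟨mem_biUnion (show ε ∈ Γ \ {δ} from ⟨hε, hεδ⟩) ⟨hD.subset hw, hwε⟩, hwx⟩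
  obtain ⟨z, D₁, hzF, hD1, hD1D, hD1F, hor⟩ := hD.isArc.exists_first_hit hFfin.isClosed
    (hFmem β h.memβ hδβ.symm y hD.isArc.right_mem (h.chordB.subset hy.1) hD.isArc.ne.symm)
    fun h' => h'.2 rfl
  have hside : ∀ c ∈ Γ, c ≠ δ → c.img ∩ D₁ ⊆ {x, z} := by
    rintro c hc hcδ w ⟨hwc, hw⟩
    by_cases hwx : w = x
    · exact Or.inl hwx
    · exact Or.inr (hD1F.subset ⟨hw, hFmem c hc hcδ w (hD1D hw) hwc hwx⟩)
  rcases hor with ⟨rfl, rfl⟩ | ⟨D₂, hD2, hDu, hDi⟩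
  · obtain ⟨B', G', h', hsub, hdis⟩ := h.cut_corner hδ hδβ hδγ hx hy hD hDT hside
    exact ⟨_, _, _, _, _, _, _, _, h', hsub, hdis⟩
  · obtain ⟨ε, hε, hzε⟩ := mem_iUnion₂.1 hzF.1
    have hεδ : ε ≠ δ := hε.2
    have hzT : z ∈ inn (A ∪ B ∪ G) := by
      refine (hDT.subset ⟨hD1D hD1.right_mem, ?_⟩).2
      rintro (rfl | rfl)
      exacts [hD1.ne rfl, hD2.ne rfl]
    obtain ⟨-, -, hεγ, x', y', E, hx', hy', hE, hET⟩ :=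
      h.exists_excursion hΓ hε.1 ⟨z, hzε.2, hzT⟩
    obtain ⟨B', G', h', hsub, hdis⟩ := h.cut_base hΓ hδ hε.1 hεδ hδγ hεγ hx hy hD hDT hx' hy' hE
      hET hD1 hD2 hDu hDi hzε.2 hside
    exact ⟨_, _, _, _, _, _, _, _, h', hsub, hdis⟩

lemma exists_cell (hΓ : IsPencil Γ γ) (h : IsTri Γ γ α β p v q A B G) :
    ∃ C, IsTriangleCellOn Γ γ C ∧ C ⊆ inn (A ∪ B ∪ G) := by
  induction hn : {δ ∈ Γ | (δ.img ∩ inn (A ∪ B ∪ G)).Nonempty}.ncard using Nat.strong_induction_on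
    generalizing α β p v q A B G with
  | _ n ih =>
    by_cases hcell : ∀ δ ∈ Γ, δ.img ∩ inn (A ∪ B ∪ G) = ∅
    · exact ⟨_, h.isTriangleCellOn hΓ hcell, Subset.rfl⟩
    push Not at hcell
    obtain ⟨δ, hδ, hmeet⟩ := hcell
    obtain ⟨α', β', p', v', q', A', B', G', h', hsub, hdis⟩ := h.exists_smaller hΓ hδ hmeet
    have hlt : {δ ∈ Γ | (δ.img ∩ inn (A' ∪ B' ∪ G')).Nonempty}.ncard < n := by
      rw [← hn]
      refine ncard_lt_ncard ⟨fun ε hε => ⟨hε.1, hε.2.mono (inter_subset_inter_right _ hsub)⟩,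
        fun hcon => ?_⟩ (hΓ.finite.subset fun _ hε => hε.1)
      obtain ⟨-, w, hw, hw'⟩ := hcon (show δ ∈ _ from ⟨hδ, hmeet⟩)
      exact hdis.notMem_of_mem_left hw' hw
    obtain ⟨C, hC, hCs⟩ := ih _ hlt h' rfl
    exact ⟨C, hC, hCs.trans hsub⟩

end IsTri

/-- The part of `α` in the closed inside of `γ` is the chord `A` of `α` from `x` to `y`. -/
structure IsSpan (γ α : JordanCurve) (A : Set Plane) (x y : Plane) : Prop where
  chord : IsChord α.img A x y
  diff_eq : A \ {x, y} = α.img ∩ γ.inside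
  inter_eq : α.img ∩ γ.img = {x, y}

lemma IsPencil.exists_isSpan {Γ : Set JordanCurve} {γ α : JordanCurve} (h : IsPencil Γ γ)
    (hα : α ∈ Γ) (hαγ : α ≠ γ) : ∃ A x y, IsSpan γ α A x y := by
  obtain ⟨o, ho, hoγ⟩ := h.exists_outside hα hαγ
  obtain ⟨t, ht, htγ⟩ := h.exists_inside hα hαγ
  have h2 := h.encard_le_two α hα γ h.mem hαγ
  obtain ⟨x, y, A, hx, hy, hA, hAi⟩ := α.exists_excursion γ.isSimpleClosed h2 ht htγ ho hoγ
  refine ⟨A, x, y, hA, hAi, Eq.symm ?_⟩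
  refine (toFinite _).eq_of_subset_of_encard_le ?_ (by rwa [encard_pair hA.isArc.ne])
  rintro z (rfl | rfl)
  · exact ⟨hA.subset hA.isArc.left_mem, hx⟩
  · exact ⟨hA.subset hA.isArc.right_mem, hy⟩

namespace IsSpan

variable {γ α : JordanCurve} {A Q R : Set Plane} {x y z : Plane}

lemma symm (h : IsSpan γ α A x y) : IsSpan γ α A y x :=
  ⟨h.chord.symm, pair_comm x y ▸ h.diff_eq, pair_comm x y ▸ h.inter_eq⟩

lemma left_mem (h : IsSpan γ α A x y) : x ∈ γ.img :=
  (h.inter_eq.symm.subset (mem_insert x _)).2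

lemma mem_of_closure (h : IsSpan γ α A x y) (hz : z ∈ α.img) (hzγ : z ∈ closure γ.inside) :
    z ∈ A := by
  rcases γ.isSimpleClosed.closure_inn_subset hzγ with h' | h'
  · exact (h.diff_eq.symm.subset ⟨hz, h'⟩).1
  · rcases h.inter_eq.subset ⟨hz, h'⟩ with rfl | rfl
    exacts [h.chord.isArc.left_mem, h.chord.isArc.right_mem]

lemma subset_closure (h : IsSpan γ α A x y) : A ⊆ closure γ.inside :=
  h.chord.isArc.subset_closure_interior.trans
    (closure_mono (h.diff_eq.subset.trans inter_subset_right))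

lemma diff_subset (h : IsSpan γ α A x y) (hu : Q ∪ R = γ.img) : A \ {x, y} ⊆ inn (Q ∪ R) := by
  rw [h.diff_eq, hu]
  exact inter_subset_right

lemma loop (h : IsSpan γ α A x y) (hG : IsLoop Q R x y) (hu : Q ∪ R = γ.img) : IsLoop A Q x y :=
  hG.crosscut h.chord.isArc (h.diff_subset hu)

lemma subset_inside (h : IsSpan γ α A x y) (hG : IsLoop Q R x y) (hu : Q ∪ R = γ.img) :
    inn (A ∪ Q) ⊆ γ.inside := by
  have := hG.crosscut_subset h.chord.isArc (h.diff_subset hu)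
  rwa [hu] at this

lemma disjoint (h : IsSpan γ α A x y) (hG : IsLoop Q R x y) (hu : Q ∪ R = γ.img) :
    Disjoint (inn (A ∪ Q)) α.img :=
  disjoint_left.2 fun _ hz hzα =>
    hz.1 (Or.inl (h.diff_eq.symm.subset ⟨hzα, h.subset_inside hG hu hz⟩).1)

lemma mem_of_mem_closure (h : IsSpan γ α A x y) (hG : IsLoop Q R x y) (hu : Q ∪ R = γ.img)
    (hz : z ∈ closure (inn (A ∪ Q))) (hzγ : z ∈ γ.img) : z ∈ Q := by
  rcases (h.loop hG hu).isSimpleClosed.closure_inn_subset hz with h' | h' | h'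
  · exact absurd hzγ (h.subset_inside hG hu h').1
  · rcases h.inter_eq.subset ⟨h.chord.subset h', hzγ⟩ with rfl | rfl
    exacts [hG.left.left_mem, hG.left.right_mem]
  · exact h'

lemma subset_or_subset (h : IsSpan γ α A x y) (hG : IsLoop Q R x y) (hu : Q ∪ R = γ.img)
    {S : Set Plane} (hS : IsPreconnected S) (hSγ : S ⊆ γ.inside) (hSA : Disjoint S A) :
    S ⊆ inn (A ∪ Q) ∨ S ⊆ inn (A ∪ R) := by
  have hA := h.chord.isArc
  refine IsPreconnected.subset_or_subset (h.loop hG hu).isSimpleClosed.isOpen_inn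
    (hG.crosscut_right hA (h.diff_subset hu)).isSimpleClosed.isOpen_inn
    (hG.crosscut_disjoint hA (h.diff_subset hu)) (fun z hz => ?_) hS
  have hz' := hSγ hz
  rw [show γ.inside = inn (Q ∪ R) by rw [hu]; rfl] at hz'
  exact (hG.crosscut_cover hA (h.diff_subset hu) hz').resolve_right
    (hSA.notMem_of_mem_left hz)

end IsSpan

/-- A half-triangle `T` on `γ` with edge `α` and further side on `β`. -/
structure IsHalfTri (Γ : Set JordanCurve) (γ α β : JordanCurve) (T : Set Plane) : Prop where
  memα : α ∈ Γ
  memβ : β ∈ Γ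
  neαγ : α ≠ γ
  neβγ : β ≠ γ
  neαβ : α ≠ β
  component : ∃ p ∈ (α.img ∪ β.img ∪ γ.img)ᶜ,
    T = connectedComponentIn (α.img ∪ β.img ∪ γ.img)ᶜ p
  subset_inside : T ⊆ γ.inside
  meetsα : (frontier T ∩ α.img).Nonempty
  meetsβ : (frontier T ∩ β.img).Nonempty
  encard_eq : (frontier T ∩ pairInts α β γ).encard = 3
  sideα : ∀ δ ∈ Γ, δ ≠ α → ((frontier T ∩ α.img) \ pairInts α β γ) ∩ δ.img = ∅
  sideγ : ∀ δ ∈ Γ, δ ≠ γ → (((frontier T ∩ γ.img) \ pairInts α β γ) ∩ δ.img).encard ≤ 1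

namespace IsHalfTri

variable {Γ : Set JordanCurve} {γ α β : JordanCurve} {T A B B₁ B₂ G Q R : Set Plane}
  {p v q x y y' z : Plane}

lemma isPreconnected (h : IsHalfTri Γ γ α β T) : IsPreconnected T := by
  obtain ⟨p, -, rfl⟩ := h.component
  exact isPreconnected_connectedComponentIn

lemma nonempty (h : IsHalfTri Γ γ α β T) : T.Nonempty := by
  obtain ⟨p, hp, rfl⟩ := h.component
  exact ⟨p, mem_connectedComponentIn hp⟩

lemma disjoint (h : IsHalfTri Γ γ α β T) : Disjoint T (α.img ∪ β.img ∪ γ.img) := by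
  obtain ⟨p, -, rfl⟩ := h.component
  exact disjoint_left.2 fun z hz => connectedComponentIn_subset _ _ hz

lemma eq_inn (h : IsHalfTri Γ γ α β T) {J : Set Plane} (hJ : IsSimpleClosed J)
    (hJX : J ⊆ α.img ∪ β.img ∪ γ.img) (hα : Disjoint (inn J) α.img)
    (hβ : Disjoint (inn J) β.img) (hγ : inn J ⊆ γ.inside) (hz : z ∈ T) (hzJ : z ∈ inn J) :
    T = inn J := by
  apply Subset.antisymm
  · rw [hJ.inn_eq hzJ]
    exact h.isPreconnected.subset_connectedComponentIn hz fun w hw hwJ =>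
      h.disjoint.notMem_of_mem_left hw (hJX hwJ)
  · obtain ⟨p, hp, rfl⟩ := h.component
    rw [connectedComponentIn_eq hz]
    refine hJ.isPreconnected_inn.subset_connectedComponentIn hzJ ?_
    rintro w hw ((h' | h') | h')
    · exact hα.notMem_of_mem_left hw h'
    · exact hβ.notMem_of_mem_left hw h'
    · exact (hγ hw).1 h'

lemma isTri (hΓ : IsPencil Γ γ) (h : IsHalfTri Γ γ α β T) (hA : IsChord α.img A p v)
    (hB : IsChord β.img B v q) (hG : IsChord γ.img G q p) (hAB : A ∩ B = {v})
    (hAγ : A ∩ γ.img ⊆ {p}) (hBγ : B ∩ γ.img ⊆ {q}) (hGα : G ∩ α.img ⊆ {p})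
    (hGβ : G ∩ β.img ⊆ {q}) (hJ : IsSimpleClosed (A ∪ B ∪ G)) (hT : T = inn (A ∪ B ∪ G)) :
    IsTri Γ γ α β p v q A B G := by
  have hTne := h.nonempty
  have hX := h.disjoint
  rw [disjoint_union_right, disjoint_union_right] at hX
  have hfr : frontier T = A ∪ B ∪ G := by
    rw [hT] at hTne ⊢
    exact hJ.frontier_inn hTne
  have hcl : A ∪ B ∪ G ⊆ closure γ.inside := by
    rw [← hfr]
    exact frontier_subset_closure.trans (closure_mono h.subset_inside)
  have hvα := hA.subset hA.isArc.right_mem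
  have hvβ := hB.subset hB.isArc.left_mem
  have hvcl : v ∈ closure γ.inside := hcl (Or.inl (Or.inr hB.isArc.left_mem))
  have hpα := hA.subset hA.isArc.left_mem
  have hpγ := hG.subset hG.isArc.right_mem
  have hαβγ : ∀ {z}, z ∈ α.img → z ∈ β.img → z ∉ γ.img := fun h1 h2 =>
    hΓ.no_three h.memα h.memβ hΓ.mem h.neαβ h.neβγ h.neαγ h1 h2
  refine ⟨h.memα, h.memβ, h.neαγ, h.neβγ, h.neαβ, hA, hB, hG, hAB, ?_, ?_, hT ▸ hTne,
    hT ▸ h.subset_inside, hT ▸ hX.1.1, hT ▸ hX.1.2, ?_, ?_⟩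
  · exact Subset.antisymm ((inter_subset_inter_right _ hG.subset).trans hBγ)
      (singleton_subset_iff.2 ⟨hB.isArc.right_mem, hG.isArc.left_mem⟩)
  · exact Subset.antisymm ((inter_subset_inter_right _ hG.subset).trans hAγ)
      (singleton_subset_iff.2 ⟨hA.isArc.left_mem, hG.isArc.right_mem⟩)
  · rintro δ hδ hδα z ⟨hzδ, hz⟩
    by_contra hcon
    refine (h.sideα δ hδ hδα).subset ⟨⟨⟨hfr ▸ Or.inl (Or.inl hz), hA.subset hz⟩, ?_⟩, hzδ⟩
    rintro ((h' | h') | h')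
    · exact hcon (Or.inr (hΓ.eq_of_mem h.memα h.memβ h.neαγ h.neβγ h.neαβ
        (hcl (Or.inl (Or.inl hz))) hvcl h'.1 h'.2 hvα hvβ))
    · exact hcon (Or.inl (hAγ ⟨hz, h'.2⟩))
    · exact hαβγ (hA.subset hz) h'.1 h'.2
  · intro δ hδ hδγ
    have key : δ.img ∩ (G \ {p, q}) ⊆ ((frontier T ∩ γ.img) \ pairInts α β γ) ∩ δ.img := by
      rintro z ⟨hzδ, hz, hzn⟩
      refine ⟨⟨⟨hfr ▸ Or.inr hz, hG.subset hz⟩, ?_⟩, hzδ⟩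
      rintro ((h' | h') | h')
      · exact hαβγ h'.1 h'.2 (hG.subset hz)
      · exact hzn (Or.inl (hGα ⟨hz, h'.1⟩))
      · exact hzn (Or.inr (hGβ ⟨hz, h'.1⟩))
    exact fun z hz w hw => encard_le_one_iff.1 (h.sideγ δ hδ hδγ) z w (key hz) (key hw)

end IsHalfTri

lemma IsArc.right_notMem {S₁ S₂ : Set Plane} {y z : Plane} (h : IsArc S₂ z y)
    (hi : S₁ ∩ S₂ = {z}) : y ∉ S₁ :=
  fun hy => h.ne.symm (hi.subset ⟨hy, h.right_mem⟩)

/-- A loop with base points `x`, `x'` also has the interior points `v`, `y` of its two sides as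
base points. -/
lemma IsLoop.rebase {A A₁ A₂ Q Q₁ Q₂ : Set Plane} {x x' v y : Plane} (h : IsLoop A Q x x')
    (hA1 : IsArc A₁ x v) (hA2 : IsArc A₂ v x') (hAu : A₁ ∪ A₂ = A) (hAi : A₁ ∩ A₂ = {v})
    (hQ1 : IsArc Q₁ x y) (hQ2 : IsArc Q₂ y x') (hQu : Q₁ ∪ Q₂ = Q) (hQi : Q₁ ∩ Q₂ = {y}) :
    IsLoop (A₁ ∪ Q₁) (A₂ ∪ Q₂) v y := by
  subst hAu hQu
  have hxA2 : x ∉ A₂ := hA1.symm.right_notMem (by rw [inter_comm, hAi])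
  have hxQ2 : x ∉ Q₂ := hQ1.symm.right_notMem (by rw [inter_comm, hQi])
  have hxA1 : x' ∉ A₁ := hA2.right_notMem hAi
  have hxQ1 : x' ∉ Q₁ := hQ2.right_notMem hQi
  refine ⟨hA1.symm.concat hQ1 ?_, hA2.concat hQ2.symm ?_, ?_⟩
  · refine Subset.antisymm ?_ (singleton_subset_iff.2 ⟨hA1.left_mem, hQ1.left_mem⟩)
    rintro z ⟨hz, hzQ⟩
    rcases h.inter.subset ⟨Or.inl hz, Or.inl hzQ⟩ with rfl | rfl
    exacts [rfl, absurd hz hxA1]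
  · refine Subset.antisymm ?_ (singleton_subset_iff.2 ⟨hA2.right_mem, hQ2.right_mem⟩)
    rintro z ⟨hz, hzQ⟩
    rcases h.inter.subset ⟨Or.inr hz, Or.inr hzQ⟩ with rfl | rfl
    exacts [absurd hz hxA2, rfl]
  · apply Subset.antisymm
    · rintro z ⟨hz | hz, hz' | hz'⟩
      · exact Or.inl (hAi.subset ⟨hz, hz'⟩)
      · rcases h.inter.subset ⟨Or.inl hz, Or.inr hz'⟩ with rfl | rfl
        exacts [absurd hz' hxQ2, absurd hz hxA1]
      · rcases h.inter.subset ⟨Or.inr hz', Or.inl hz⟩ with rfl | rfl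
        exacts [absurd hz' hxA2, absurd hz hxQ1]
      · exact Or.inr (hQi.subset ⟨hz, hz'⟩)
    · rintro z (rfl | rfl)
      · exact ⟨Or.inl hA1.right_mem, Or.inl hA2.left_mem⟩
      · exact ⟨Or.inr hQ1.right_mem, Or.inr hQ2.left_mem⟩

namespace IsHalfTri

variable {Γ : Set JordanCurve} {γ α β : JordanCurve} {T A A₁ A₂ B B₁ B₂ Q Q₁ Q₂ R : Set Plane}
  {v x x' y y' z : Plane}

/-- The two spans of a half-triangle meet. -/
lemma inter_nonempty (hΓ : IsPencil Γ γ) (h : IsHalfTri Γ γ α β T) (sA : IsSpan γ α A x x')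
    (sB : IsSpan γ β B y y') (hG : IsLoop Q R x x') (hu : Q ∪ R = γ.img)
    (hT : T ⊆ inn (A ∪ Q)) : (A ∩ B).Nonempty := by
  by_contra hcon
  have hAB : ∀ z ∈ A, z ∉ B := fun z hz hz' => hcon ⟨z, hz, hz'⟩
  have hA := sA.chord.isArc
  have hB := sB.chord.isArc
  have hloop := sA.loop hG hu
  have hαβγ : ∀ {z}, z ∈ α.img → z ∈ β.img → z ∉ γ.img := fun h1 h2 =>
    hΓ.no_three h.memα h.memβ hΓ.mem h.neαβ h.neβγ h.neαγ h1 h2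
  have hxβ : ∀ z ∈ β.img, z ∈ γ.img → z ∉ ({x, x'} : Set Plane) := by
    intro z hz hzγ hzx
    exact hαβγ (sA.inter_eq.symm.subset hzx).1 hz hzγ
  have hyβ := sB.chord.subset hB.left_mem
  have hy'β := sB.chord.subset hB.right_mem
  have hcl : frontier T ⊆ closure γ.inside :=
    frontier_subset_closure.trans (closure_mono h.subset_inside)
  have hBu : B \ {y, y'} ⊆ γ.inside := sB.diff_eq.subset.trans inter_subset_right
  obtain ⟨t, ht⟩ := h.nonempty
  have hQγ : Q ⊆ γ.img := hu ▸ subset_union_left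
  have hX : A ∪ Q ⊆ α.img ∪ β.img ∪ γ.img :=
    union_subset_union (sA.chord.subset.trans subset_union_left) hQγ
  rcases sA.subset_or_subset hG hu hB.isPreconnected_interior hBu
    (disjoint_left.2 fun z hz hz' => hAB z hz' hz.1) with hBQ | hBR
  · have hmem : ∀ z ∈ B, z ∈ γ.img → z ∈ Q \ {x, x'} := fun z hz hzγ =>
      ⟨sA.mem_of_mem_closure hG hu (closure_mono hBQ (hB.subset_closure_interior hz)) hzγ,
        hxβ z (sB.chord.subset hz) hzγ⟩
    obtain ⟨M, -, hMQ, hMc⟩ := hG.left.exists_subarc (hmem y hB.left_mem sB.left_mem)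
      (hmem y' hB.right_mem sB.symm.left_mem) hB.ne
    obtain ⟨L, hML, hMLu⟩ := hMc (A ∪ Q) (by rw [union_comm]; exact hloop.symm.isChord)
    have hPi : B \ {y, y'} ⊆ inn (M ∪ L) := by rwa [hMLu]
    have hPi' : B \ {y, y'} ⊆ inn (L ∪ M) := by rwa [union_comm]
    have key : ∀ K, K ⊆ A ∪ Q → IsSimpleClosed (B ∪ K) → inn (B ∪ K) ⊆ inn (A ∪ Q) →
        t ∈ inn (B ∪ K) → T = inn (B ∪ K) := fun K hK hJ hsub htK =>
      h.eq_inn hJ (union_subset (sB.chord.subset.trans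
        (subset_union_right.trans subset_union_left)) (hK.trans hX))
        ((sA.disjoint hG hu).mono_left hsub)
        (disjoint_left.2 fun z hz hzβ => hz.1 (Or.inl (sB.diff_eq.symm.subset
          ⟨hzβ, sA.subset_inside hG hu (hsub hz)⟩).1))
        (hsub.trans (sA.subset_inside hG hu)) ht htK
    have htu : t ∈ inn (M ∪ L) := hMLu ▸ hT ht
    rcases hML.crosscut_cover hB hPi htu with (htM | htL) | htB
    · have hJ := (hML.crosscut hB hPi).isSimpleClosed
      have hTM := key M (hMLu ▸ subset_union_left) hJ (hMLu ▸ hML.crosscut_subset hB hPi) htM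
      obtain ⟨w, hw, hwα⟩ := h.meetsα
      have hwA := sA.mem_of_closure hwα (hcl hw)
      rw [hTM, hJ.frontier_inn ⟨t, htM⟩] at hw
      rcases hw with hw | hw
      · exact hAB w hwA hw
      · exact (hMQ hw).2 (sA.inter_eq.subset ⟨hwα, hQγ (hMQ hw).1⟩)
    · have hJ := (hML.crosscut_right hB hPi).isSimpleClosed
      have hsub := hML.symm.crosscut_subset hB hPi'
      rw [union_comm L, hMLu] at hsub
      have hTL := key L (hMLu ▸ subset_union_right) hJ hsub htL
      have hfr : frontier T = B ∪ L := by rw [hTL, hJ.frontier_inn ⟨t, htL⟩]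
      have hxL : ∀ z ∈ ({x, x'} : Set Plane), z ∈ frontier T ∩ pairInts α β γ := by
        intro z hz
        have hzA : z ∈ A := by
          rcases hz with rfl | rfl
          exacts [hA.left_mem, hA.right_mem]
        have hzL : z ∈ L := (hMLu.symm.subset (Or.inl hzA)).resolve_left fun h' => (hMQ h').2 hz
        exact ⟨hfr ▸ Or.inr hzL, Or.inl (Or.inr (sA.inter_eq.symm.subset hz))⟩
      have hyL : ∀ z ∈ ({y, y'} : Set Plane), z ∈ frontier T ∩ pairInts α β γ := by
        intro z hz
        have hzB : z ∈ B := by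
          rcases hz with rfl | rfl
          exacts [hB.left_mem, hB.right_mem]
        exact ⟨hfr ▸ Or.inl hzB, Or.inr (sB.inter_eq.symm.subset hz)⟩
      have h4 : (({x, x'} : Set Plane) ∪ {y, y'}).encard = 4 := by
        rw [encard_union_eq, encard_pair hA.ne, encard_pair hB.ne]
        · norm_num
        · refine disjoint_left.2 fun z hz hz' => ?_
          have hzβ := sB.inter_eq.symm.subset hz'
          exact hxβ z hzβ.1 hzβ.2 hz
      have hle := encard_le_encard (union_subset hxL hyL)
      rw [h4, h.encard_eq] at hle
      norm_num at hle
    · exact h.disjoint.notMem_of_mem_left ht (Or.inl (Or.inr (sB.chord.subset htB)))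
  · have hdis := hG.crosscut_disjoint hA (sA.diff_subset hu)
    have hTQ : T = inn (A ∪ Q) := by
      refine h.eq_inn hloop.isSimpleClosed hX (sA.disjoint hG hu)
        (disjoint_left.2 fun z hz hzβ => ?_) (sA.subset_inside hG hu) ht (hT ht)
      exact hdis.notMem_of_mem_left hz (hBR (sB.diff_eq.symm.subset
        ⟨hzβ, sA.subset_inside hG hu hz⟩))
    obtain ⟨w, hw, hwβ⟩ := h.meetsβ
    have hwB := sB.mem_of_closure hwβ (hcl hw)
    rw [hTQ, hloop.isSimpleClosed.frontier_inn ⟨t, hT ht⟩] at hw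
    rcases hw with hw | hw
    · exact hAB w hw hwB
    · have hwR := sA.mem_of_mem_closure hG.symm (by rwa [union_comm])
        (closure_mono hBR (hB.subset_closure_interior hwB)) (hQγ hw)
      exact hxβ w hwβ (hQγ hw) (hG.inter.subset ⟨hw, hwR⟩)

lemma isTri_of_corner (hΓ : IsPencil Γ γ) (h : IsHalfTri Γ γ α β T) (sA : IsSpan γ α A x x')
    (sB : IsSpan γ β B y y') (hG : IsLoop Q R x x') (hu : Q ∪ R = γ.img)
    (hA1 : IsArc A₁ x v) (hA2 : IsArc A₂ v x') (hAu : A₁ ∪ A₂ = A) (hAi : A₁ ∩ A₂ = {v})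
    (hB1 : IsArc B₁ y v) (hB2 : IsArc B₂ v y') (hBu : B₁ ∪ B₂ = B) (hBi : B₁ ∩ B₂ = {v})
    (hQ1 : IsArc Q₁ x y) (hQ2 : IsArc Q₂ y x') (hQu : Q₁ ∪ Q₂ = Q) (hQi : Q₁ ∩ Q₂ = {y})
    (hyQ : y' ∉ Q) (hβ : β.img ∩ inn (A ∪ Q) ⊆ B₁)
    (hJ : IsSimpleClosed (B₁ ∪ (A₁ ∪ Q₁))) (hsub : inn (B₁ ∪ (A₁ ∪ Q₁)) ⊆ inn (A ∪ Q))
    (hz : z ∈ T) (hzi : z ∈ inn (B₁ ∪ (A₁ ∪ Q₁))) :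
    IsTri Γ γ α β x v y A₁ B₁ Q₁ ∧ T = inn (A₁ ∪ B₁ ∪ Q₁) := by
  have heq : B₁ ∪ (A₁ ∪ Q₁) = A₁ ∪ B₁ ∪ Q₁ := by rw [union_left_comm, union_assoc]
  have cA := sA.chord.split_left hA1 hA2 hAu hAi
  have cB := sB.chord.split_left hB1 hB2 hBu hBi
  have cG : IsChord γ.img Q₁ x y := (hu ▸ hG.isChord).split_left hQ1 hQ2 hQu hQi
  have hA1A : A₁ ⊆ A := hAu ▸ subset_union_left
  have hB1B : B₁ ⊆ B := hBu ▸ subset_union_left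
  have hQ1Q : Q₁ ⊆ Q := hQu ▸ subset_union_left
  have hT : T = inn (B₁ ∪ (A₁ ∪ Q₁)) :=
    h.eq_inn hJ (union_subset (cB.subset.trans (subset_union_right.trans subset_union_left))
      (union_subset_union (cA.subset.trans subset_union_left) cG.subset))
      ((sA.disjoint hG hu).mono_left hsub)
      (disjoint_left.2 fun w hw hwβ => hw.1 (Or.inl (hβ ⟨hwβ, hsub hw⟩)))
      (hsub.trans (sA.subset_inside hG hu)) hz hzi
  rw [heq] at hJ hT
  refine ⟨h.isTri hΓ cA cB.symm cG.symm ?_ ?_ ?_ ?_ ?_ hJ hT, hT⟩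
  · refine Subset.antisymm ?_ (singleton_subset_iff.2 ⟨hA1.right_mem, hB1.right_mem⟩)
    rintro w ⟨hw, hw'⟩
    exact hΓ.eq_of_mem h.memα h.memβ h.neαγ h.neβγ h.neαβ (sA.subset_closure (hA1A hw))
      (sA.subset_closure (hA1A hA1.right_mem)) (cA.subset hw) (cB.subset hw')
      (cA.subset hA1.right_mem) (cB.subset hB1.right_mem)
  · rintro w ⟨hw, hw'⟩
    rcases sA.inter_eq.subset ⟨cA.subset hw, hw'⟩ with rfl | rfl
    exacts [rfl, absurd hw (hA2.right_notMem hAi)]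
  · rintro w ⟨hw, hw'⟩
    rcases sB.inter_eq.subset ⟨cB.subset hw, hw'⟩ with rfl | rfl
    exacts [rfl, absurd hw (hB2.right_notMem hBi)]
  · rintro w ⟨hw, hw'⟩
    rcases sA.inter_eq.subset ⟨hw', cG.subset hw⟩ with rfl | rfl
    exacts [rfl, absurd hw (hQ2.right_notMem hQi)]
  · rintro w ⟨hw, hw'⟩
    rcases sB.inter_eq.subset ⟨hw', cG.subset hw⟩ with rfl | rfl
    exacts [rfl, absurd (hQ1Q hw) hyQ]

lemma exists_isTri_of_split (hΓ : IsPencil Γ γ) (h : IsHalfTri Γ γ α β T)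
    (sA : IsSpan γ α A x x') (sB : IsSpan γ β B y y') (hG : IsLoop Q R x x')
    (hu : Q ∪ R = γ.img) (hT : T ⊆ inn (A ∪ Q)) (hv : v ∈ A)
    (hB1 : IsArc B₁ y v) (hB2 : IsArc B₂ v y') (hBu : B₁ ∪ B₂ = B) (hBi : B₁ ∩ B₂ = {v})
    (hBQ : B₁ \ {y, v} ⊆ inn (A ∪ Q)) (hBR : B₂ \ {v, y'} ⊆ inn (A ∪ R)) :
    ∃ p q A' B' G', IsTri Γ γ α β p v q A' B' G' ∧ T = inn (A' ∪ B' ∪ G') := by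
  have hαβγ : ∀ {z}, z ∈ α.img → z ∈ β.img → z ∉ γ.img := fun h1 h2 =>
    hΓ.no_three h.memα h.memβ hΓ.mem h.neαβ h.neβγ h.neαγ h1 h2
  have hxα : ∀ z ∈ ({x, x'} : Set Plane), z ∈ α.img ∩ γ.img := fun z hz =>
    sA.inter_eq.symm.subset hz
  have hyβ : ∀ z ∈ ({y, y'} : Set Plane), z ∈ β.img ∩ γ.img := fun z hz =>
    sB.inter_eq.symm.subset hz
  have hvγ : v ∉ γ.img := hαβγ (sA.chord.subset hv)
    (sB.chord.subset (hBu ▸ Or.inl hB1.right_mem))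
  have hne : ∀ z ∈ ({y, y'} : Set Plane), z ∉ ({x, x'} : Set Plane) := fun z hz hz' =>
    hαβγ (hxα z hz').1 (hyβ z hz).1 (hyβ z hz).2
  have hu' : R ∪ Q = γ.img := by rwa [union_comm]
  have hyQ : y ∈ Q := sA.mem_of_mem_closure hG hu
    (closure_mono hBQ (hB1.subset_closure_interior hB1.left_mem)) sB.left_mem
  have hy'R : y' ∈ R := sA.mem_of_mem_closure hG.symm hu'
    (closure_mono hBR (hB2.subset_closure_interior hB2.right_mem)) sB.symm.left_mem
  have hy'Q : y' ∉ Q := fun h' => hne y' (Or.inr rfl) (hG.inter.subset ⟨h', hy'R⟩)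
  have hβ : β.img ∩ inn (A ∪ Q) ⊆ B₁ := by
    rintro z ⟨hzβ, hz⟩
    have hzB := sB.diff_eq.symm.subset ⟨hzβ, sA.subset_inside hG hu hz⟩
    refine (hBu.symm.subset hzB.1).resolve_right fun hz2 => ?_
    refine (hG.crosscut_disjoint sA.chord.isArc (sA.diff_subset hu)).notMem_of_mem_left hz
      (hBR ⟨hz2, ?_⟩)
    rintro (rfl | rfl)
    · exact hz.1 (Or.inl hv)
    · exact hzB.2 (Or.inr rfl)
  obtain ⟨A₁, A₂, hA1, hA2, hAu, hAi⟩ := sA.chord.isArc.split hv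
    (fun h' => hvγ (h' ▸ sA.left_mem)) fun h' => hvγ (h' ▸ sA.symm.left_mem)
  obtain ⟨Q₁, Q₂, hQ1, hQ2, hQu, hQi⟩ := hG.left.split hyQ
    (fun h' => hne y (Or.inl rfl) (Or.inl h')) fun h' => hne y (Or.inl rfl) (Or.inr h')
  have hloop := (sA.loop hG hu).rebase hA1 hA2 hAu hAi hQ1 hQ2 hQu hQi
  have heq : A₁ ∪ Q₁ ∪ (A₂ ∪ Q₂) = A ∪ Q := by rw [union_union_union_comm, hAu, hQu]
  have hPi : B₁ \ {v, y} ⊆ inn (A₁ ∪ Q₁ ∪ (A₂ ∪ Q₂)) := by rwa [heq, pair_comm]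
  have hPi' : B₁ \ {v, y} ⊆ inn (A₂ ∪ Q₂ ∪ (A₁ ∪ Q₁)) := by rwa [union_comm]
  obtain ⟨t, ht⟩ := h.nonempty
  have hti : t ∈ inn (A₁ ∪ Q₁ ∪ (A₂ ∪ Q₂)) := heq ▸ hT ht
  rcases hloop.crosscut_cover hB1.symm hPi hti with (ht1 | ht2) | htB
  · have hsub := hloop.crosscut_subset hB1.symm hPi
    rw [heq] at hsub
    exact ⟨_, _, _, _, _, h.isTri_of_corner hΓ sA sB hG hu hA1 hA2 hAu hAi hB1 hB2 hBu hBi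
      hQ1 hQ2 hQu hQi hy'Q hβ (hloop.crosscut hB1.symm hPi).isSimpleClosed hsub ht ht1⟩
  · have hsub := hloop.symm.crosscut_subset hB1.symm hPi'
    rw [union_comm (A₂ ∪ Q₂), heq] at hsub
    exact ⟨_, _, _, _, _, h.isTri_of_corner hΓ sA.symm sB hG.swap hu hA2.symm hA1.symm
      (by rw [union_comm, hAu]) (by rw [inter_comm, hAi]) hB1 hB2 hBu hBi hQ2.symm hQ1.symm
      (by rw [union_comm, hQu]) (by rw [inter_comm, hQi]) hy'Q hβ
      (hloop.crosscut_right hB1.symm hPi).isSimpleClosed hsub ht ht2⟩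
  · exact absurd (Or.inl (Or.inr (sB.chord.subset (hBu ▸ Or.inl htB))))
      (h.disjoint.notMem_of_mem_left ht)

lemma exists_isTri_of_subset (hΓ : IsPencil Γ γ) (h : IsHalfTri Γ γ α β T)
    (sA : IsSpan γ α A x x') (sB : IsSpan γ β B y y') (hG : IsLoop Q R x x')
    (hu : Q ∪ R = γ.img) (hT : T ⊆ inn (A ∪ Q)) :
    ∃ p v q A' B' G', IsTri Γ γ α β p v q A' B' G' ∧ T = inn (A' ∪ B' ∪ G') := by
  obtain ⟨v, hv, hvB⟩ := h.inter_nonempty hΓ sA sB hG hu hT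
  have hA := sA.chord.isArc
  have hu' : R ∪ Q = γ.img := by rwa [union_comm]
  have hvα := sA.chord.subset hv
  have hvβ := sB.chord.subset hvB
  have hvγ : v ∉ γ.img :=
    hΓ.no_three h.memα h.memβ hΓ.mem h.neαβ h.neβγ h.neαγ hvα hvβ
  obtain ⟨B₁, B₂, hB1, hB2, hBu, hBi⟩ := sB.chord.isArc.split hvB
    (fun h' => hvγ (h' ▸ sB.left_mem)) fun h' => hvγ (h' ▸ sB.symm.left_mem)
  have hvx : v ∉ ({x, x'} : Set Plane) := fun h' => hvγ (sA.inter_eq.symm.subset h').2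
  have hcr := hΓ.crossing h.memβ h.memα h.neαβ.symm hvβ hvα
  have meet : ∀ {K L : Set Plane}, IsLoop K L x x' → K ∪ L = γ.img →
      (β.img ∩ inn (A ∪ K)).Nonempty := fun {K L} hKL hKu => by
    have hl := sA.loop hKL hKu
    refine exists_mem_inn_of_crossing sA.chord hl.isSimpleClosed hKL.left.isClosed
      (by rw [inter_comm, hl.inter]) ⟨hv, hvx⟩ hcr
      (hKL.crosscut_nonempty hA (sA.diff_subset hKu)) (sA.disjoint hKL hKu)
  have side : ∀ {S : Set Plane}, S ⊆ B → IsPreconnected (S \ {y, y', v}) →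
      S \ {y, y', v} ⊆ inn (A ∪ Q) ∨ S \ {y, y', v} ⊆ inn (A ∪ R) := fun {S} hS hc => by
    refine sA.subset_or_subset hG hu hc (fun z hz => ?_) (disjoint_left.2 fun z hz hzA => ?_)
    · exact (sB.diff_eq.subset ⟨hS hz.1, fun h' => hz.2 (h'.imp_right Or.inl)⟩).2
    · exact hz.2 (Or.inr (Or.inr (hΓ.eq_of_mem h.memα h.memβ h.neαγ h.neβγ h.neαβ
        (sA.subset_closure hzA) (sA.subset_closure hv) (sA.chord.subset hzA)
        (sB.chord.subset (hS hz.1)) hvα hvβ)))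
  have hd1 : B₁ \ {y, v} = B₁ \ {y, y', v} := by
    have := hB2.right_notMem hBi
    ext w
    have : w ∈ B₁ → w ≠ y' := fun hw e => this (e ▸ hw)
    simp only [mem_sdiff, mem_insert_iff, mem_singleton_iff]
    tauto
  have hd2 : B₂ \ {v, y'} = B₂ \ {y, y', v} := by
    have := hB1.symm.right_notMem (S₁ := B₂) (by rw [inter_comm, hBi])
    ext w
    have : w ∈ B₂ → w ≠ y := fun hw e => this (e ▸ hw)
    simp only [mem_sdiff, mem_insert_iff, mem_singleton_iff]
    tauto
  have hs1 := side (hBu ▸ subset_union_left) (hd1 ▸ hB1.isPreconnected_interior)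
  have hs2 := side (hBu ▸ subset_union_right) (hd2 ▸ hB2.isPreconnected_interior)
  rw [← hd1] at hs1
  rw [← hd2] at hs2
  have hdis := hG.crosscut_disjoint hA (sA.diff_subset hu)
  have absurd_of : ∀ {K L : Set Plane}, IsLoop K L x x' → K ∪ L = γ.img →
      Disjoint (inn (A ∪ K)) (inn (A ∪ L)) → B₁ \ {y, v} ⊆ inn (A ∪ L) →
      B₂ \ {v, y'} ⊆ inn (A ∪ L) → False := fun {K L} hKL hKu hd h1 h2 => by
    obtain ⟨w, hwβ, hw⟩ := meet hKL hKu
    have hwB := sB.diff_eq.symm.subset ⟨hwβ, sA.subset_inside hKL hKu hw⟩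
    have hwv : w ≠ v := by
      rintro rfl
      exact hw.1 (Or.inl hv)
    rcases hBu.symm.subset hwB.1 with hw' | hw'
    · exact hd.notMem_of_mem_left hw (h1 ⟨hw', fun h' => h'.elim (fun e => hwB.2 (Or.inl e)) hwv⟩)
    · exact hd.notMem_of_mem_left hw (h2 ⟨hw', fun h' => h'.elim hwv fun e => hwB.2 (Or.inr e)⟩)
  rcases hs1 with h1 | h1 <;> rcases hs2 with h2 | h2
  · exact (absurd_of hG.symm hu' hdis.symm h1 h2).elim
  · obtain ⟨p, q, A', B', G', h'⟩ :=
      h.exists_isTri_of_split hΓ sA sB hG hu hT hv hB1 hB2 hBu hBi h1 h2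
    exact ⟨p, v, q, A', B', G', h'⟩
  · obtain ⟨p, q, A', B', G', h'⟩ :=
      h.exists_isTri_of_split hΓ sA sB.symm hG hu hT hv hB2.symm hB1.symm
        (by rw [union_comm, hBu]) (by rw [inter_comm, hBi]) (by rwa [pair_comm])
        (by rwa [pair_comm])
    exact ⟨p, v, q, A', B', G', h'⟩
  · exact (absurd_of hG hu hdis h1 h2).elim

lemma exists_isTri (hΓ : IsPencil Γ γ) (h : IsHalfTri Γ γ α β T) :
    ∃ p v q A B G, IsTri Γ γ α β p v q A B G ∧ T = inn (A ∪ B ∪ G) := by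
  obtain ⟨A, x, x', sA⟩ := hΓ.exists_isSpan h.memα h.neαγ
  obtain ⟨B, y, y', sB⟩ := hΓ.exists_isSpan h.memβ h.neβγ
  obtain ⟨Q, R, hG, hu⟩ := γ.exists_loop sA.left_mem sA.symm.left_mem sA.chord.isArc.ne
  rcases sA.subset_or_subset hG hu h.isPreconnected h.subset_inside
    (h.disjoint.mono_right (sA.chord.subset.trans (subset_union_left.trans subset_union_left)))
    with hT | hT
  · exact h.exists_isTri_of_subset hΓ sA sB hG hu hT
  · exact h.exists_isTri_of_subset hΓ sA sB hG.symm (by rwa [union_comm]) hT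

end IsHalfTri

/-- A half-triangle on `γ` with edge `α` (its side on `α` crossed by no other curve), whose
side on `γ` is crossed at most once by every other curve, contains a triangle cell on `γ`. -/
theorem half_triangle_contains_triangle_cell
    (Γ : Set JordanCurve) (hΓfin : Γ.Finite) (hgp : GeneralPosition Γ)
    (h2 : ∀ a ∈ Γ, ∀ b ∈ Γ, a ≠ b → (a.img ∩ b.img).encard ≤ 2)
    (γ : JordanCurve) (hγ : γ ∈ Γ)
    (hmeet : ∀ a ∈ Γ, a ≠ γ → (a.img ∩ γ.img).Nonempty)
    (h1 : ∀ a ∈ Γ \ {γ}, ∀ b ∈ Γ \ {γ}, a ≠ b →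
        (a.img ∩ b.img ∩ closure γ.inside).encard ≤ 1)
    (α β : JordanCurve) (hα : α ∈ Γ) (hβ : β ∈ Γ)
    (hαγ : α ≠ γ) (hβγ : β ≠ γ) (hαβ : α ≠ β)
    (T : Set Plane)
    (hTcomp : ∃ p ∈ (α.img ∪ β.img ∪ γ.img)ᶜ,
        T = connectedComponentIn (α.img ∪ β.img ∪ γ.img)ᶜ p)
    (hTin : T ⊆ γ.inside)
    (hTα : (frontier T ∩ α.img).Nonempty)
    (hTβ : (frontier T ∩ β.img).Nonempty)
    (hTγ : (frontier T ∩ γ.img).Nonempty)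
    (hTverts : (frontier T ∩ pairInts α β γ).encard = 3)
    (hsideα : ∀ δ ∈ Γ, δ ≠ α →
        ((frontier T ∩ α.img) \ pairInts α β γ) ∩ δ.img = ∅)
    (hsideγ : ∀ δ ∈ Γ, δ ≠ γ →
        ((((frontier T ∩ γ.img) \ pairInts α β γ)) ∩ δ.img).encard ≤ 1) :
    ∃ C : Set Plane, IsTriangleCellOn Γ γ C ∧ C ⊆ T := by
  have hΓ : IsPencil Γ γ := ⟨hΓfin, hgp, h2, hγ, hmeet, h1⟩
  have h : IsHalfTri Γ γ α β T :=
    ⟨hα, hβ, hαγ, hβγ, hαβ, hTcomp, hTin, hTα, hTβ, hTverts, hsideα, hsideγ⟩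
  obtain ⟨p, v, q, A, B, G, hTri, rfl⟩ := h.exists_isTri hΓ
  exact hTri.exists_cell hΓ
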